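/- arXiv:1205.3251 — 5 statements merged into one kernel-verified Lean document; each statement's English description precedes it below -/
import Mathlib

section
/- For every extremizing sequence (f_n) for the inequality ‖T f‖_{L^q(ν)} ≤ B ‖f‖_{L^p(μ)} there exist a subsequence (still denoted f_n) and a sequence of positive reals λ_n such that the rescaled functions r ↦ λ_n^{d/p} f_n(λ_n r) converge strongly in L^p(μ). In other words, extremizing sequences are relatively compact in L^p(μ) modulo the group of dilations. -/
open MeasureTheory Set Filter Topology

noncomputable section

/-- The measure `r^(d-1) dr` on `(0, ∞)`. -/
def mu (d : ℕ) : Measure ℝ :=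
  (volume.restrict (Ioi (0:ℝ))).withDensity (fun r => ENNReal.ofReal (r ^ (d - 1)))

/-- The measure `r^(d-k-1) dr` on `(0, ∞)`. -/
def nu (d k : ℕ) : Measure ℝ :=
  (volume.restrict (Ioi (0:ℝ))).withDensity (fun r => ENNReal.ofReal (r ^ (d - k - 1)))

/-- The one-dimensional model operator for the k-plane transform on radial functions. -/
def T (k : ℕ) (f : ℝ → ℝ) (r : ℝ) : ℝ :=
  ∫ u in Ioi r, f u * (u ^ 2 - r ^ 2) ^ ((k : ℝ) / 2 - 1) * u

/-- `p = (d+1)/(k+1)`. -/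
def pExp (d k : ℕ) : ℝ := ((d : ℝ) + 1) / ((k : ℝ) + 1)

/-- `q = d+1`. -/
def qExp (d : ℕ) : ℝ := (d : ℝ) + 1

/-- `B` is the best constant in the `L^p(μ) → L^q(ν)` inequality for `T`. -/
def IsBestConstant (d k : ℕ) (B : ℝ) : Prop :=
  IsLeast {C : ℝ | 0 ≤ C ∧ ∀ f : ℝ → ℝ, Measurable f → (∀ r, 0 ≤ f r) →
    eLpNorm (T k f) (ENNReal.ofReal (qExp d)) (nu d k) ≤
      ENNReal.ofReal C * eLpNorm f (ENNReal.ofReal (pExp d k)) (mu d)} B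

/-- `(f n)` is an extremizing sequence for the inequality. -/
def Extremizing (d k : ℕ) (B : ℝ) (f : ℕ → ℝ → ℝ) : Prop :=
  (∀ n, Measurable (f n)) ∧ (∀ n r, 0 ≤ f n r) ∧
  (∀ n, eLpNorm (f n) (ENNReal.ofReal (pExp d k)) (mu d) = 1) ∧
  Tendsto (fun n => (eLpNorm (T k (f n)) (ENNReal.ofReal (qExp d)) (nu d k)).toReal)
    atTop (𝓝 B)

section Correlation

open scoped ENNReal

/-- The `L^p` size of a nonnegative function on the line. -/
def lpSize (p : ℝ) (F : ℝ → ℝ≥0∞) : ℝ≥0∞ := (∫⁻ x, F x ^ p) ^ (1 / p)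

/-- The correlation `t ↦ ∫ K (x - t) F x dx` of nonnegative functions on the line. -/
def corr (K F : ℝ → ℝ≥0∞) (t : ℝ) : ℝ≥0∞ := ∫⁻ x, K (x - t) * F x

lemma lpSize_rpow {p : ℝ} (hp : 0 < p) (F : ℝ → ℝ≥0∞) : lpSize p F ^ p = ∫⁻ x, F x ^ p := by
  rw [lpSize, ← ENNReal.rpow_mul, one_div_mul_cancel hp.ne', ENNReal.rpow_one]

lemma lpSize_mono {p : ℝ} (hp : 0 < p) {F G : ℝ → ℝ≥0∞} (h : ∀ x, F x ≤ G x) :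
    lpSize p F ≤ lpSize p G := by
  unfold lpSize
  gcongr with x
  exact h x

lemma lpSize_add_le {p : ℝ} (hp : 1 ≤ p) {F G : ℝ → ℝ≥0∞} (hF : Measurable F)
    (hG : Measurable G) : lpSize p (fun x => F x + G x) ≤ lpSize p F + lpSize p G :=
  ENNReal.lintegral_Lp_add_le hF.aemeasurable hG.aemeasurable hp

lemma lpSize_const_mul {p : ℝ} (hp : 0 < p) (c : ℝ≥0∞) {F : ℝ → ℝ≥0∞} (hF : Measurable F) :
    lpSize p (fun x => c * F x) = c * lpSize p F := by
  unfold lpSize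
  simp_rw [ENNReal.mul_rpow_of_nonneg _ _ hp.le]
  rw [lintegral_const_mul _ (hF.pow_const p), ENNReal.mul_rpow_of_nonneg _ _ (by positivity),
    ← ENNReal.rpow_mul, mul_one_div_cancel hp.ne', ENNReal.rpow_one]

lemma measurable_corr {K F : ℝ → ℝ≥0∞} (hK : Measurable K) (hF : Measurable F) :
    Measurable (corr K F) := by
  unfold corr
  exact Measurable.lintegral_prod_right' (f := fun z : ℝ × ℝ => K (z.2 - z.1) * F z.2)
    (by fun_prop)

lemma corr_add_kernel {K L F : ℝ → ℝ≥0∞} (hK : Measurable K) (hF : Measurable F) (t : ℝ) :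
    corr (fun x => K x + L x) F t = corr K F t + corr L F t := by
  unfold corr
  rw [← lintegral_add_left (by fun_prop)]
  simp_rw [add_mul]

lemma corr_add {K F G : ℝ → ℝ≥0∞} (hK : Measurable K) (hF : Measurable F) (t : ℝ) :
    corr K (fun x => F x + G x) t = corr K F t + corr K G t := by
  unfold corr
  rw [← lintegral_add_left (by fun_prop)]
  simp_rw [mul_add]

lemma corr_mono {K L F G : ℝ → ℝ≥0∞} (hKL : ∀ x, K x ≤ L x) (hFG : ∀ x, F x ≤ G x) (t : ℝ) :
    corr K F t ≤ corr L G t :=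
  lintegral_mono fun _ => mul_le_mul' (hKL _) (hFG _)

lemma corr_translate (K F : ℝ → ℝ≥0∞) (a t : ℝ) :
    corr K (fun x => F (x + a)) t = corr K F (t + a) := by
  unfold corr
  rw [← lintegral_add_right_eq_self (fun x => K (x - (t + a)) * F x) a]
  congr with x
  ring_nf

lemma lpSize_translate (p : ℝ) (F : ℝ → ℝ≥0∞) (a : ℝ) :
    lpSize p (fun x => F (x + a)) = lpSize p F := by
  unfold lpSize
  rw [lintegral_add_right_eq_self (fun x => F x ^ p) a]

/-- The **Young inequality** for correlations. -/
lemma lpSize_corr_le {p q s : ℝ} (hp : 1 ≤ p) (hpq : p ≤ q) (hs : 0 < s)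
    (h : 1 / p + 1 / s = 1 + 1 / q) {K F : ℝ → ℝ≥0∞} (hK : Measurable K) (hF : Measurable F) :
    lpSize q (corr K F) ≤ lpSize s K * lpSize p F := by
  have hp0 : 0 < p := by linarith
  have hq0 : 0 < q := by linarith
  have e1 : 0 ≤ 1 / s - 1 / q := by
    have : 1 / p ≤ 1 := by rw [div_le_one hp0]; exact hp
    linarith
  have e2 : 0 ≤ 1 / p - 1 / q := by
    have := one_div_le_one_div_of_le hp0 hpq
    linarith
  have e0 : 0 ≤ 1 / q := by positivity
  set A := ∫⁻ x, K x ^ s with hA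
  set D := ∫⁻ x, F x ^ p with hD
  have key : ∀ t, corr K F t ≤ (∫⁻ x, K (x - t) ^ s * F x ^ p) ^ (1 / q)
      * (A ^ (1 / s - 1 / q) * D ^ (1 / p - 1 / q)) := by
    intro t
    have hol := ENNReal.lintegral_prod_norm_pow_le (μ := (volume : Measure ℝ))
      (Finset.univ : Finset (Fin 3))
      (f := ![fun x => K (x - t) ^ s * F x ^ p, fun x => K (x - t) ^ s, fun x => F x ^ p])
      (p := ![1 / q, 1 / s - 1 / q, 1 / p - 1 / q])
      (by intro i _; fin_cases i <;> simp <;> fun_prop)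
      (by simp only [Fin.sum_univ_three]; simp; simp at h; linarith)
      (by intro i _; fin_cases i <;> simp only [Fin.zero_eta, Fin.mk_one, Fin.reduceFinMk,
            Matrix.cons_val] <;> assumption)
    simp only [Fin.prod_univ_three, Matrix.cons_val] at hol
    rw [lintegral_sub_right_eq_self (fun x => K x ^ s) t, mul_assoc] at hol
    refine le_trans (le_of_eq ?_) hol
    unfold corr
    congr with x
    rw [ENNReal.mul_rpow_of_nonneg _ _ e0]
    simp_rw [← ENNReal.rpow_mul]
    have a1 : K (x - t) = K (x - t) ^ (s * (1 / q)) * K (x - t) ^ (s * (1 / s - 1 / q)) := by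
      rw [← ENNReal.rpow_add_of_nonneg _ _ (by positivity) (by positivity)]
      have : s * (1 / q) + s * (1 / s - 1 / q) = 1 := by field_simp; ring
      rw [this, ENNReal.rpow_one]
    have a2 : F x = F x ^ (p * (1 / q)) * F x ^ (p * (1 / p - 1 / q)) := by
      rw [← ENNReal.rpow_add_of_nonneg _ _ (by positivity) (by positivity)]
      have : p * (1 / q) + p * (1 / p - 1 / q) = 1 := by field_simp; ring
      rw [this, ENNReal.rpow_one]
    conv_lhs => rw [a1, a2]
    ring
  have dbl : ∫⁻ t, ∫⁻ x, K (x - t) ^ s * F x ^ p = A * D := by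
    rw [lintegral_lintegral_swap (by fun_prop)]
    have : ∀ x, ∫⁻ t, K (x - t) ^ s * F x ^ p = A * F x ^ p := by
      intro x
      rw [lintegral_mul_const _ (by fun_prop), lintegral_sub_left_eq_self (fun x => K x ^ s) x]
    simp_rw [this]
    rw [lintegral_const_mul _ (by fun_prop)]
  have fin : lpSize q (corr K F) ≤ (A * D) ^ (1 / q) * (A ^ (1 / s - 1 / q) * D ^ (1 / p - 1 / q)) := by
    refine (lpSize_mono hq0 key).trans (le_of_eq ?_)
    simp_rw [mul_comm _ (A ^ (1 / s - 1 / q) * D ^ (1 / p - 1 / q))]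
    rw [lpSize_const_mul hq0]
    · congr 1
      unfold lpSize
      simp_rw [← ENNReal.rpow_mul, one_div_mul_cancel hq0.ne', ENNReal.rpow_one, dbl]
    · exact (Measurable.lintegral_prod_right'
        (f := fun z : ℝ × ℝ => K (z.2 - z.1) ^ s * F z.2 ^ p) (by fun_prop)).pow_const _
  refine fin.trans (le_of_eq ?_)
  rw [ENNReal.mul_rpow_of_nonneg _ _ e0]
  unfold lpSize
  rw [← hA, ← hD]
  have a1 : A ^ (1 / s) = A ^ (1 / q) * A ^ (1 / s - 1 / q) := by
    rw [← ENNReal.rpow_add_of_nonneg _ _ (by positivity) (by positivity)]; ring_nf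
  have a2 : D ^ (1 / p) = D ^ (1 / q) * D ^ (1 / p - 1 / q) := by
    rw [← ENNReal.rpow_add_of_nonneg _ _ (by positivity) (by positivity)]; ring_nf
  rw [a1, a2]
  ring

end Correlation

section Truncation

open scoped ENNReal

/-- The set on which a kernel is kept by truncation at level `M`. -/
def coreSet (K : ℝ → ℝ≥0∞) (M : ℝ) : Set ℝ := {x | |x| ≤ M ∧ K x ≤ ENNReal.ofReal M}

/-- The bounded, compactly supported part of a kernel. -/
def core (K : ℝ → ℝ≥0∞) (M : ℝ) : ℝ → ℝ≥0∞ := (coreSet K M).indicator K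

/-- The part of a kernel removed by truncation. -/
def coreCompl (K : ℝ → ℝ≥0∞) (M : ℝ) : ℝ → ℝ≥0∞ := (coreSet K M)ᶜ.indicator K

lemma measurableSet_coreSet {K : ℝ → ℝ≥0∞} (hK : Measurable K) (M : ℝ) :
    MeasurableSet (coreSet K M) :=
  (measurableSet_le continuous_abs.measurable measurable_const).inter
    (measurableSet_le hK measurable_const)

lemma measurable_core {K : ℝ → ℝ≥0∞} (hK : Measurable K) (M : ℝ) : Measurable (core K M) :=
  hK.indicator (measurableSet_coreSet hK M)

lemma measurable_coreCompl {K : ℝ → ℝ≥0∞} (hK : Measurable K) (M : ℝ) :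
    Measurable (coreCompl K M) :=
  hK.indicator (measurableSet_coreSet hK M).compl

lemma core_add_coreCompl (K : ℝ → ℝ≥0∞) (M x : ℝ) : core K M x + coreCompl K M x = K x := by
  classical
  by_cases h : x ∈ coreSet K M <;> simp [core, coreCompl, h]

lemma core_le (K : ℝ → ℝ≥0∞) (M x : ℝ) : core K M x ≤ K x := indicator_le_self _ _ _

lemma core_le_indicator (K : ℝ → ℝ≥0∞) (M x : ℝ) :
    core K M x ≤ (Icc (-M) M).indicator (fun _ => ENNReal.ofReal M) x := by
  by_cases h : x ∈ coreSet K M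
  · rw [core, indicator_of_mem h, indicator_of_mem (mem_Icc.2 (abs_le.1 h.1))]
    exact h.2
  · simp [core, h]

lemma core_eq_zero {K : ℝ → ℝ≥0∞} {M x : ℝ} (h : M < |x|) : core K M x = 0 :=
  indicator_of_notMem (fun hx => absurd hx.1 (not_le.2 h)) _

lemma exists_lpSize_coreCompl_le {K : ℝ → ℝ≥0∞} (hK : Measurable K) {s : ℝ} (hs : 0 < s)
    (hKs : ∫⁻ x, K x ^ s ≠ ∞) {η : ℝ≥0∞} (hη : 0 < η) :
    ∃ M : ℝ, 0 < M ∧ lpSize s (coreCompl K M) ≤ η := by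
  have hfin : ∀ᵐ x, K x < ∞ := by
    filter_upwards [ae_lt_top (hK.pow_const s) hKs] with x hx
    exact (ENNReal.rpow_lt_top_iff_of_pos hs).1 hx
  have lim : Tendsto (fun n : ℕ => ∫⁻ x, coreCompl K n x ^ s) atTop (𝓝 (∫⁻ _ : ℝ, 0)) := by
    refine tendsto_lintegral_of_dominated_convergence (fun x => K x ^ s)
      (fun n => (measurable_coreCompl hK n).pow_const s) (fun n => ?_) hKs ?_
    · filter_upwards with x
      gcongr
      exact indicator_le_self _ _ _
    · filter_upwards [hfin] with x hx
      refine tendsto_const_nhds.congr' ?_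
      obtain ⟨N, hN⟩ := exists_nat_ge (max |x| (K x).toReal)
      filter_upwards [eventually_ge_atTop N] with n hn
      have hn' : (N : ℝ) ≤ n := by exact_mod_cast hn
      have : x ∈ coreSet K n := by
        refine ⟨(le_max_left _ _).trans (hN.trans hn'), ?_⟩
        rw [ENNReal.le_ofReal_iff_toReal_le hx.ne (by positivity)]
        exact (le_max_right _ _).trans (hN.trans hn')
      simp [coreCompl, this, hs]
  have lim2 : Tendsto (fun n : ℕ => lpSize s (coreCompl K n)) atTop (𝓝 0) := by
    have := (ENNReal.continuous_rpow_const (y := 1 / s)).continuousAt.tendsto.comp lim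
    simpa [hs, lpSize, Function.comp_def] using this
  obtain ⟨n, hn, hn0⟩ := ((lim2.eventually (ge_mem_nhds hη)).and (eventually_gt_atTop 0)).exists
  exact ⟨n, by exact_mod_cast hn0, hn⟩

/-- The constant in the local bound for correlation with a truncated kernel. -/
def coreConst (p M : ℝ) : ℝ≥0∞ := ENNReal.ofReal M * ENNReal.ofReal (2 * M) ^ (1 - 1 / p)

lemma coreConst_ne_top {p : ℝ} (hp : 1 ≤ p) (M : ℝ) : coreConst p M ≠ ∞ := by
  have : 0 ≤ 1 - 1 / p := by
    rw [sub_nonneg, div_le_one (by linarith)]; exact hp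
  exact ENNReal.mul_ne_top ENNReal.ofReal_ne_top
    (ENNReal.rpow_ne_top_of_nonneg this ENNReal.ofReal_ne_top)

lemma corr_core_le {p : ℝ} (hp : 1 ≤ p) (K : ℝ → ℝ≥0∞) {F : ℝ → ℝ≥0∞} (hF : Measurable F)
    (M t : ℝ) :
    corr (core K M) F t ≤ coreConst p M * (∫⁻ x in Icc (t - M) (t + M), F x ^ p) ^ (1 / p) := by
  have hp0 : 0 < p := by linarith
  have e : 0 ≤ 1 - 1 / p := by
    rw [sub_nonneg, div_le_one (by linarith)]; exact hp
  calc corr (core K M) F t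
      ≤ ∫⁻ x, (Icc (t - M) (t + M)).indicator (fun x => ENNReal.ofReal M * F x) x := by
        refine lintegral_mono fun x => ?_
        refine (mul_le_mul_left (core_le_indicator K M _) (F x)).trans (le_of_eq ?_)
        by_cases h : x ∈ Icc (t - M) (t + M)
        · rw [indicator_of_mem h, indicator_of_mem]
          exact ⟨by linarith [h.1], by linarith [h.2]⟩
        · rw [indicator_of_notMem h, indicator_of_notMem, zero_mul]
          exact fun h' => h ⟨by linarith [h'.1], by linarith [h'.2]⟩
    _ = ENNReal.ofReal M * ∫⁻ x in Icc (t - M) (t + M), F x := by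
        rw [lintegral_indicator measurableSet_Icc, lintegral_const_mul _ hF]
    _ ≤ ENNReal.ofReal M * ((∫⁻ x in Icc (t - M) (t + M), F x ^ p) ^ (1 / p)
          * (∫⁻ x in Icc (t - M) (t + M), 1) ^ (1 - 1 / p)) := by
        gcongr
        have := ENNReal.lintegral_mul_norm_pow_le (μ := volume.restrict (Icc (t - M) (t + M)))
          (f := fun x => F x ^ p) (g := fun _ => 1) (by fun_prop) (by fun_prop)
          (p := 1 / p) (q := 1 - 1 / p) (by positivity) e (by ring)
        simpa [← ENNReal.rpow_mul, hp0.ne'] using this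
    _ = _ := by
        rw [coreConst]
        simp only [lintegral_const, MeasurableSet.univ, Measure.restrict_apply, univ_inter,
          Real.volume_Icc, one_mul]
        rw [show t + M - (t - M) = 2 * M by ring]
        ring

lemma lintegral_window {G : ℝ → ℝ≥0∞} (hG : Measurable G) (M : ℝ) :
    ∫⁻ t, ∫⁻ x in Icc (t - M) (t + M), G x = ENNReal.ofReal (2 * M) * ∫⁻ x, G x := by
  have h1 : ∀ t, ∫⁻ x in Icc (t - M) (t + M), G x
      = ∫⁻ x, (Icc (-M) M).indicator (fun _ => (1 : ℝ≥0∞)) (x - t) * G x := by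
    intro t
    rw [← lintegral_indicator measurableSet_Icc]
    congr with x
    by_cases h : x ∈ Icc (t - M) (t + M)
    · rw [indicator_of_mem h, indicator_of_mem, one_mul]
      exact ⟨by linarith [h.1], by linarith [h.2]⟩
    · rw [indicator_of_notMem h, indicator_of_notMem, zero_mul]
      exact fun h' => h ⟨by linarith [h'.1], by linarith [h'.2]⟩
  have hm : Measurable ((Icc (-M) M).indicator (fun _ => (1 : ℝ≥0∞))) :=
    measurable_const.indicator measurableSet_Icc
  simp_rw [h1]
  rw [lintegral_lintegral_swap (by fun_prop)]
  have : ∀ x, ∫⁻ t, (Icc (-M) M).indicator (fun _ => (1 : ℝ≥0∞)) (x - t) * G x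
      = ENNReal.ofReal (2 * M) * G x := by
    intro x
    rw [lintegral_mul_const _ (by fun_prop), lintegral_sub_left_eq_self
      ((Icc (-M) M).indicator (fun _ => (1 : ℝ≥0∞))) x, lintegral_indicator measurableSet_Icc]
    simp only [lintegral_const, MeasurableSet.univ, Measure.restrict_apply, univ_inter,
      Real.volume_Icc, one_mul]
    ring_nf
  simp_rw [this]
  rw [lintegral_const_mul _ hG]

/-- If a function has little mass in every window, then correlating it with a truncated kernel
gives a function of small norm. -/
lemma lpSize_corr_core_le_of_window {p q : ℝ} (hp : 1 ≤ p) (hpq : p < q) (K : ℝ → ℝ≥0∞)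
    {F : ℝ → ℝ≥0∞} (hF : Measurable F) (hF1 : ∫⁻ x, F x ^ p ≤ 1) {M : ℝ} {δ : ℝ≥0∞}
    (hδ : ∀ t, ∫⁻ x in Icc (t - M) (t + M), F x ^ p ≤ δ) :
    lpSize q (corr (core K M) F) ≤
      coreConst p M * (δ ^ (q / p - 1) * ENNReal.ofReal (2 * M)) ^ (1 / q) := by
  have hp0 : 0 < p := by linarith
  have hq0 : 0 < q := by linarith
  have e : 0 < q / p - 1 := by rw [sub_pos, lt_div_iff₀ hp0]; linarith
  set J : ℝ → ℝ≥0∞ := fun t => ∫⁻ x in Icc (t - M) (t + M), F x ^ p with hJ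
  have bd : ∫⁻ t, corr (core K M) F t ^ q
      ≤ coreConst p M ^ q * (δ ^ (q / p - 1) * ENNReal.ofReal (2 * M)) := by
    have hδ' : ∀ t, J t ≤ min δ 1 := fun t =>
      le_min (hδ t) ((setLIntegral_le_lintegral _ _).trans hF1)
    have hmin : min δ 1 ≠ ∞ := (min_le_right δ 1).trans_lt ENNReal.one_lt_top |>.ne
    calc ∫⁻ t, corr (core K M) F t ^ q
        ≤ ∫⁻ t, coreConst p M ^ q * (min δ 1) ^ (q / p - 1) * J t := by
          refine lintegral_mono fun t => ?_
          calc corr (core K M) F t ^ q ≤ (coreConst p M * J t ^ (1 / p)) ^ q := by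
                gcongr; exact corr_core_le hp K hF M t
            _ = coreConst p M ^ q * (J t ^ (q / p - 1) * J t) := by
                rw [ENNReal.mul_rpow_of_nonneg _ _ hq0.le, ← ENNReal.rpow_mul]
                congr 1
                conv_rhs => rw [← ENNReal.rpow_one (J t), ← ENNReal.rpow_mul, one_mul]
                rw [← ENNReal.rpow_add_of_nonneg _ _ e.le zero_le_one]
                congr 1; ring
            _ ≤ _ := by
                rw [mul_assoc]
                gcongr
                exact hδ' t
      _ = coreConst p M ^ q * (min δ 1) ^ (q / p - 1) * (ENNReal.ofReal (2 * M) * ∫⁻ x, F x ^ p) := by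
          rw [lintegral_const_mul' _ _ (ENNReal.mul_ne_top
            (ENNReal.rpow_ne_top_of_nonneg hq0.le (coreConst_ne_top hp M))
            (ENNReal.rpow_ne_top_of_nonneg e.le hmin)), lintegral_window (by fun_prop)]
      _ ≤ coreConst p M ^ q * δ ^ (q / p - 1) * (ENNReal.ofReal (2 * M) * 1) := by
          gcongr; exact min_le_left _ _
      _ = _ := by ring
  calc lpSize q (corr (core K M) F)
      ≤ (coreConst p M ^ q * (δ ^ (q / p - 1) * ENNReal.ofReal (2 * M))) ^ (1 / q) := by
        unfold lpSize; gcongr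
    _ = _ := by
        rw [ENNReal.mul_rpow_of_nonneg _ _ (by positivity), ← ENNReal.rpow_mul,
          mul_one_div_cancel hq0.ne', ENNReal.rpow_one]

lemma lpSize_corr_le_core_add {q : ℝ} (hq : 1 ≤ q) {K F : ℝ → ℝ≥0∞} (hK : Measurable K)
    (hF : Measurable F) (M : ℝ) :
    lpSize q (corr K F) ≤ lpSize q (corr (core K M) F) + lpSize q (corr (coreCompl K M) F) := by
  refine le_trans (le_of_eq ?_) (lpSize_add_le hq (measurable_corr (measurable_core hK M) hF)
    (measurable_corr (measurable_coreCompl hK M) hF))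
  congr 1 with t
  rw [← corr_add_kernel (measurable_core hK M) hF]
  simp_rw [core_add_coreCompl]

end Truncation

section Tightness

open scoped ENNReal

/-- Correlation with `K` is bounded from `L^p` to `L^q` with constant `b`, where the exponents are
those of Young's inequality for a kernel in `L^s`. -/
structure YoungBound (p q s : ℝ) (K : ℝ → ℝ≥0∞) (b : ℝ≥0∞) : Prop where
  one_lt : 1 < p
  lt : p < q
  pos : 0 < s
  exponents : 1 / p + 1 / s = 1 + 1 / q
  measurable : Measurable K
  lintegral_ne_top : ∫⁻ x, K x ^ s ≠ ∞
  const_pos : 0 < b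
  const_ne_top : b ≠ ∞
  bound : ∀ F : ℝ → ℝ≥0∞, Measurable F → lpSize q (corr K F) ≤ b * lpSize p F

/-- A normalized sequence whose images under correlation with `K` have norm tending to `b`. -/
structure CorrExtremizing (p q : ℝ) (K : ℝ → ℝ≥0∞) (b : ℝ≥0∞) (F : ℕ → ℝ → ℝ≥0∞) : Prop where
  measurable : ∀ n, Measurable (F n)
  norm_eq : ∀ n, ∫⁻ x, F n x ^ p = 1
  tendsto : Tendsto (fun n => lpSize q (corr K (F n))) atTop (𝓝 b)

variable {p q s : ℝ} {K : ℝ → ℝ≥0∞} {b : ℝ≥0∞} {F : ℕ → ℝ → ℝ≥0∞}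

lemma exists_pos_add_add_lt {a b : ℝ≥0∞} (h : a < b) : ∃ κ : ℝ≥0∞, 0 < κ ∧ a + κ + κ < b := by
  obtain ⟨r, hr, hab⟩ := ENNReal.lt_iff_exists_add_pos_lt.1 h
  refine ⟨r / 2, ENNReal.half_pos (by exact_mod_cast hr.ne'), ?_⟩
  rwa [add_assoc, ENNReal.add_halves]

lemma CorrExtremizing.lpSize_eq_one (hF : CorrExtremizing p q K b F) (n : ℕ) :
    lpSize p (F n) = 1 := by
  rw [lpSize, hF.norm_eq, ENNReal.one_rpow]

lemma CorrExtremizing.translate (hF : CorrExtremizing p q K b F) (τ : ℕ → ℝ) :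
    CorrExtremizing p q K b (fun n x => F n (x + τ n)) where
  measurable n := (hF.measurable n).comp (by fun_prop)
  norm_eq n := by rw [lintegral_add_right_eq_self (fun x => F n x ^ p), hF.norm_eq n]
  tendsto := by
    refine hF.tendsto.congr fun n => ?_
    rw [← lpSize_translate q _ (τ n)]
    congr 1 with t
    rw [corr_translate]

lemma CorrExtremizing.subseq (hF : CorrExtremizing p q K b F) {σ : ℕ → ℕ} (hσ : StrictMono σ) :
    CorrExtremizing p q K b (fun n => F (σ n)) where
  measurable _ := hF.measurable _
  norm_eq _ := hF.norm_eq _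
  tendsto := hF.tendsto.comp hσ.tendsto_atTop

lemma YoungBound.lpSize_coreCompl_le (hK : YoungBound p q s K b) {G : ℝ → ℝ≥0∞}
    (hG : Measurable G) (M : ℝ) :
    lpSize q (corr (coreCompl K M) G) ≤ lpSize s (coreCompl K M) * lpSize p G :=
  lpSize_corr_le hK.one_lt.le hK.lt.le hK.pos hK.exponents (measurable_coreCompl hK.measurable M) hG

lemma YoungBound.lpSize_core_le (hK : YoungBound p q s K b) {G : ℝ → ℝ≥0∞}
    (hG : Measurable G) (M : ℝ) : lpSize q (corr (core K M) G) ≤ b * lpSize p G :=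
  (lpSize_mono (by linarith [hK.one_lt, hK.lt]) (corr_mono (core_le K M) fun _ => le_rfl)).trans
    (hK.bound G hG)

/-- An extremizing sequence does not vanish: up to translations, it keeps a fixed amount of mass in
a fixed window. -/
lemma CorrExtremizing.exists_window (hK : YoungBound p q s K b)
    (hF : CorrExtremizing p q K b F) :
    ∃ M : ℝ, ∃ δ : ℝ≥0∞, 0 < δ ∧ ∃ τ : ℕ → ℝ,
      ∀ᶠ n in atTop, δ ≤ ∫⁻ x in {x | |x| ≤ M}, F n (x + τ n) ^ p := by
  have hp0 : 0 < p := by linarith [hK.one_lt]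
  have hq0 : 0 < q := by linarith [hK.lt]
  have hq1 : 1 ≤ q := by linarith [hK.lt, hK.one_lt]
  obtain ⟨η, hη, hηb⟩ := exists_pos_add_add_lt hK.const_pos
  rw [zero_add] at hηb
  obtain ⟨M, hM0, hM⟩ := exists_lpSize_coreCompl_le hK.measurable hK.pos hK.lintegral_ne_top hη
  have e : 0 < q / p - 1 := by rw [sub_pos, lt_div_iff₀ hp0]; linarith [hK.lt]
  have lim : Tendsto (fun δ : ℝ≥0∞ =>
      coreConst p M * (δ ^ (q / p - 1) * ENNReal.ofReal (2 * M)) ^ (1 / q)) (𝓝 0) (𝓝 0) := by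
    have c : Continuous (fun δ : ℝ≥0∞ =>
      coreConst p M * (δ ^ (q / p - 1) * ENNReal.ofReal (2 * M)) ^ (1 / q)) :=
      (ENNReal.continuous_const_mul (coreConst_ne_top hK.one_lt.le M)).comp
        (ENNReal.continuous_rpow_const.comp
          ((ENNReal.continuous_mul_const ENNReal.ofReal_ne_top).comp
            ENNReal.continuous_rpow_const))
    have := c.tendsto 0
    rwa [ENNReal.zero_rpow_of_pos e, zero_mul, ENNReal.zero_rpow_of_pos (by positivity),
      mul_zero] at this
  obtain ⟨δ, hδ, hδ0⟩ := (((lim.eventually (ge_mem_nhds hη)).filter_mono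
    (nhdsWithin_le_nhds (s := Ioi 0))).and (eventually_mem_nhdsWithin)).exists
  have key : ∀ᶠ n in atTop, ∃ t, δ ≤ ∫⁻ x in {x | |x| ≤ M}, F n (x + t) ^ p := by
    filter_upwards [hF.tendsto.eventually (lt_mem_nhds hηb)] with n hn
    by_contra! hcon
    refine absurd hn (not_lt.2 ?_)
    refine (lpSize_corr_le_core_add hq1 hK.measurable (hF.measurable n) M).trans ?_
    refine add_le_add ((lpSize_corr_core_le_of_window hK.one_lt.le hK.lt K (hF.measurable n)
      (hF.norm_eq n).le (δ := δ) fun t => ?_).trans hδ) ?_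
    · refine le_trans (le_of_eq ?_) (hcon t).le
      rw [← lintegral_indicator measurableSet_Icc, ← lintegral_indicator
        (measurableSet_le continuous_abs.measurable measurable_const),
        ← lintegral_add_right_eq_self _ t]
      congr with x
      simp only [indicator, mem_Icc, mem_ofPred_eq, abs_le]
      congr 1
      apply propext
      constructor <;> rintro ⟨h1, h2⟩ <;> constructor <;> linarith
    · refine (hK.lpSize_coreCompl_le (hF.measurable n) M).trans ?_
      rw [hF.lpSize_eq_one, mul_one]
      exact hM
  classical
  refine ⟨M, δ, hδ0, fun n => if h : ∃ t, δ ≤ ∫⁻ x in {x | |x| ≤ M}, F n (x + t) ^ p then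
    h.choose else 0, ?_⟩
  filter_upwards [key] with n hn
  rw [dif_pos hn]
  exact hn.choose_spec

lemma measurableSet_abs_le (ρ : ℝ) : MeasurableSet {x : ℝ | |x| ≤ ρ} :=
  measurableSet_le continuous_abs.measurable measurable_const

lemma measurableSet_lt_abs (ρ : ℝ) : MeasurableSet {x : ℝ | ρ < |x|} :=
  measurableSet_lt measurable_const continuous_abs.measurable

lemma lpSize_indicator (hp : 0 < p) (G : ℝ → ℝ≥0∞) {S : Set ℝ} (hS : MeasurableSet S) :
    lpSize p (S.indicator G) = (∫⁻ x in S, G x ^ p) ^ (1 / p) := by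
  rw [lpSize, ← lintegral_indicator hS]
  congr with x
  by_cases h : x ∈ S <;> simp [h, hp]

/-- Splitting a function into three pieces so that the images of the outer two under a truncated
kernel have disjoint supports. -/
lemma YoungBound.lpSize_corr_core_le_split (hK : YoungBound p q s K b) {G : ℝ → ℝ≥0∞}
    (hG : Measurable G) (M ρ : ℝ) :
    lpSize q (corr (core K M) G) ≤
      b * (∫⁻ x in {x | ρ < |x| ∧ |x| ≤ ρ + 2 * M}, G x ^ p) ^ (1 / p) +
      b * ((∫⁻ x in {x | |x| ≤ ρ}, G x ^ p) ^ (q / p)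
        + (∫⁻ x in {x | ρ + 2 * M < |x|}, G x ^ p) ^ (q / p)) ^ (1 / q) := by
  have hp0 : 0 < p := by linarith [hK.one_lt]
  have hq0 : 0 < q := by linarith [hK.lt]
  have hq1 : 1 ≤ q := by linarith [hK.lt, hK.one_lt]
  set S₁ := {x : ℝ | |x| ≤ ρ} with hS₁
  set S₂ := {x : ℝ | ρ < |x| ∧ |x| ≤ ρ + 2 * M} with hS₂
  set S₃ := {x : ℝ | ρ + 2 * M < |x|} with hS₃
  have m₁ : MeasurableSet S₁ := measurableSet_abs_le ρ
  have m₂ : MeasurableSet S₂ := (measurableSet_lt_abs ρ).inter (measurableSet_abs_le _)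
  have m₃ : MeasurableSet S₃ := measurableSet_lt_abs _
  have hc := measurable_core hK.measurable M
  have g₁ := hG.indicator m₁
  have g₂ := hG.indicator m₂
  have g₃ := hG.indicator m₃
  set C := core K M with hC
  have disj : ∀ t, corr C (S₁.indicator G) t = 0 ∨ corr C (S₃.indicator G) t = 0 := by
    intro t
    rcases le_or_gt |t| (ρ + M) with ht | ht
    · right
      unfold corr
      rw [lintegral_eq_zero_iff (by fun_prop)]
      filter_upwards with x
      by_cases hx : x ∈ S₃
      · have : M < |x - t| := by
          have := abs_sub_abs_le_abs_sub x t
          have hx' : ρ + 2 * M < |x| := hx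
          linarith
        simp [hC, core_eq_zero this]
      · simp [hx]
    · left
      unfold corr
      rw [lintegral_eq_zero_iff (by fun_prop)]
      filter_upwards with x
      by_cases hx : x ∈ S₁
      · have : M < |x - t| := by
          have := abs_sub_abs_le_abs_sub t x
          rw [abs_sub_comm] at this
          have hx' : |x| ≤ ρ := hx
          linarith
        simp [hC, core_eq_zero this]
      · simp [hx]
  have outer : lpSize q (corr C (fun x => S₁.indicator G x + S₃.indicator G x)) ≤
      b * ((∫⁻ x in S₁, G x ^ p) ^ (q / p) + (∫⁻ x in S₃, G x ^ p) ^ (q / p)) ^ (1 / q) := by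
    have single : ∀ S, MeasurableSet S →
        ∫⁻ t, corr C (S.indicator G) t ^ q ≤ b ^ q * (∫⁻ x in S, G x ^ p) ^ (q / p) := by
      intro S hS
      rw [← lpSize_rpow hq0]
      refine (ENNReal.rpow_le_rpow (hK.lpSize_core_le (hG.indicator hS) M) hq0.le).trans
        (le_of_eq ?_)
      rw [lpSize_indicator hp0 G hS, ENNReal.mul_rpow_of_nonneg _ _ hq0.le, ← ENNReal.rpow_mul]
      congr 2
      ring
    have sum : ∫⁻ t, corr C (fun x => S₁.indicator G x + S₃.indicator G x) t ^ q
        = (∫⁻ t, corr C (S₁.indicator G) t ^ q) + ∫⁻ t, corr C (S₃.indicator G) t ^ q := by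
      rw [← lintegral_add_left ((measurable_corr hc g₁).pow_const q)]
      congr with t
      rw [corr_add hc g₁]
      rcases disj t with h | h <;> simp [h, hq0]
    rw [lpSize, sum]
    refine (ENNReal.rpow_le_rpow (add_le_add (single S₁ m₁) (single S₃ m₃))
      (z := 1 / q) (by positivity)).trans (le_of_eq ?_)
    rw [← mul_add, ENNReal.mul_rpow_of_nonneg _ _ (by positivity), ← ENNReal.rpow_mul,
      mul_one_div_cancel hq0.ne', ENNReal.rpow_one]
  have dec : ∀ x, G x ≤ S₂.indicator G x + (S₁.indicator G x + S₃.indicator G x) := by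
    intro x
    by_cases h1 : x ∈ S₁
    · rw [indicator_of_mem h1]
      exact le_self_add.trans le_add_self
    · by_cases h3 : x ∈ S₃
      · rw [indicator_of_mem h3]
        exact le_add_self.trans le_add_self
      · have : x ∈ S₂ := ⟨not_le.1 h1, not_lt.1 h3⟩
        rw [indicator_of_mem this]
        exact le_self_add
  calc lpSize q (corr C G)
      ≤ lpSize q (fun t => corr C (S₂.indicator G) t
          + corr C (fun x => S₁.indicator G x + S₃.indicator G x) t) := by
        refine lpSize_mono hq0 fun t => ?_
        rw [← corr_add hc g₂]
        exact corr_mono (fun _ => le_rfl) dec t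
    _ ≤ _ := lpSize_add_le hq1 (measurable_corr hc g₂) (measurable_corr hc (g₁.add g₃))
    _ ≤ _ := by
        refine add_le_add ?_ outer
        rw [← lpSize_indicator hp0 G m₂]
        exact hK.lpSize_core_le g₂ M

lemma exists_annulus_le {G : ℝ → ℝ≥0∞} (hG1 : ∫⁻ x, G x ≤ 1) {M : ℝ}
    (hM : 0 < M) (ρ : ℝ) {L : ℕ} (hL : 0 < L) :
    ∃ j < L, ∫⁻ x in {x | ρ + 2 * M * j < |x| ∧ |x| ≤ ρ + 2 * M * j + 2 * M}, G x
      ≤ (L : ℝ≥0∞)⁻¹ := by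
  by_contra! hcon
  set S : ℕ → Set ℝ := fun j => {x | ρ + 2 * M * j < |x| ∧ |x| ≤ ρ + 2 * M * j + 2 * M} with hS
  have hm : ∀ j, MeasurableSet (S j) := fun j =>
    (measurableSet_lt_abs _).inter (measurableSet_abs_le _)
  have hlt : ∀ i j : ℕ, i < j → Disjoint (S i) (S j) := by
    intro i j hij
    rw [Set.disjoint_left]
    rintro x ⟨_, h1⟩ ⟨h2, _⟩
    have : (i : ℝ) + 1 ≤ j := by exact_mod_cast hij
    nlinarith
  have hd : Set.PairwiseDisjoint (↑(Finset.range L)) S := by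
    intro i _ j _ hij
    rcases lt_or_gt_of_ne hij with h | h
    · exact hlt i j h
    · exact (hlt j i h).symm
  have h1 : ∑ j ∈ Finset.range L, ∫⁻ x in S j, G x ≤ 1 := by
    rw [← lintegral_biUnion_finset hd (fun j _ => hm j)]
    exact (setLIntegral_le_lintegral _ _).trans hG1
  have h2 : ∑ j ∈ Finset.range L, (L : ℝ≥0∞)⁻¹ < ∑ j ∈ Finset.range L, ∫⁻ x in S j, G x :=
    ENNReal.sum_lt_sum_of_nonempty (Finset.nonempty_range_iff.2 hL.ne')
      (fun j hj => hcon j (Finset.mem_range.1 hj))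
  rw [Finset.sum_const, Finset.card_range, nsmul_eq_mul,
    ENNReal.mul_inv_cancel (by exact_mod_cast hL.ne') (by finiteness)] at h2
  exact absurd (h2.trans_le h1) (lt_irrefl _)

/-- **Tightness**: an extremizing sequence that keeps mass in a fixed window has uniformly small
tails. -/
lemma CorrExtremizing.tight (hK : YoungBound p q s K b) (hF : CorrExtremizing p q K b F) {M₀ : ℝ}
    {δ : ℝ≥0∞} (hδ : 0 < δ) (hw : ∀ᶠ n in atTop, δ ≤ ∫⁻ x in {x | |x| ≤ M₀}, F n x ^ p)
    {ε : ℝ≥0∞} (hε : 0 < ε) :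
    ∃ R : ℝ, ∀ᶠ n in atTop, ∫⁻ x in {x | R < |x|}, F n x ^ p ≤ ε := by
  have hp0 : 0 < p := by linarith [hK.one_lt]
  have hq0 : 0 < q := by linarith [hK.lt]
  have hq1 : 1 ≤ q := by linarith [hK.lt, hK.one_lt]
  have e : 0 < q / p - 1 := by rw [sub_pos, lt_div_iff₀ hp0]; linarith [hK.lt]
  set θ : ℝ≥0∞ := 1 - min δ ε with hθ
  have hθ1 : θ < 1 := ENNReal.sub_lt_self ENNReal.one_ne_top one_ne_zero (lt_min hδ hε).ne'
  have hγ : b * (θ ^ (q / p - 1)) ^ (1 / q) < b := by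
    conv_rhs => rw [← mul_one b]
    rw [ENNReal.mul_lt_mul_iff_right hK.const_pos.ne' hK.const_ne_top]
    exact ENNReal.rpow_lt_one (ENNReal.rpow_lt_one hθ1 e) (by positivity)
  obtain ⟨κ, hκ, hκb⟩ := exists_pos_add_add_lt hγ
  obtain ⟨M, hM0, hM⟩ := exists_lpSize_coreCompl_le hK.measurable hK.pos hK.lintegral_ne_top hκ
  have lim : Tendsto (fun L : ℕ => b * ((L : ℝ≥0∞)⁻¹) ^ (1 / p)) atTop (𝓝 0) := by
    have c : Continuous (fun x : ℝ≥0∞ => b * x ^ (1 / p)) :=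
      (ENNReal.continuous_const_mul hK.const_ne_top).comp ENNReal.continuous_rpow_const
    have := (c.tendsto 0).comp ENNReal.tendsto_inv_nat_nhds_zero
    rwa [ENNReal.zero_rpow_of_pos (by positivity), mul_zero] at this
  obtain ⟨L, hL, hL0⟩ := ((lim.eventually (ge_mem_nhds hκ)).and (eventually_gt_atTop 0)).exists
  refine ⟨M₀ + 2 * M * L, ?_⟩
  filter_upwards [hw, hF.tendsto.eventually (lt_mem_nhds hκb)] with n hn hnb
  by_contra! hcon
  refine absurd hnb (not_lt.2 ?_)
  obtain ⟨j, hjL, hj⟩ := exists_annulus_le (hF.norm_eq n).le hM0 M₀ hL0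
  set ρ := M₀ + 2 * M * j with hρ
  have hjL' : (j : ℝ) + 1 ≤ L := by exact_mod_cast hjL
  set A := ∫⁻ x in {x | |x| ≤ ρ}, F n x ^ p with hA
  set C := ∫⁻ x in {x | ρ + 2 * M < |x|}, F n x ^ p with hC
  have hAδ : δ ≤ A := hn.trans (lintegral_mono_set fun x (hx : |x| ≤ M₀) => by
    have : 0 ≤ 2 * M * j := by positivity
    exact hx.trans (by linarith))
  have hCε : ε ≤ C := hcon.le.trans (lintegral_mono_set fun x (hx : M₀ + 2 * M * L < |x|) => by
    refine lt_of_le_of_lt ?_ hx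
    nlinarith)
  have hAC : A + C ≤ 1 := by
    rw [← hF.norm_eq n, hA, hC, ← lintegral_union (measurableSet_lt_abs _)]
    · exact setLIntegral_le_lintegral _ _
    · rw [Set.disjoint_left]
      intro x (hx : |x| ≤ ρ) (hx' : ρ + 2 * M < |x|)
      linarith
  have hC1 : C ≤ 1 := le_add_self.trans hAC
  have hA1 : A ≤ 1 := le_self_add.trans hAC
  have hAθ : A ≤ θ := (ENNReal.le_sub_of_add_le_right (hC1.trans_lt ENNReal.one_lt_top).ne hAC).trans
    (tsub_le_tsub_left ((min_le_right _ _).trans hCε) 1)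
  have hCθ : C ≤ θ := (ENNReal.le_sub_of_add_le_left (hA1.trans_lt ENNReal.one_lt_top).ne hAC).trans
    (tsub_le_tsub_left ((min_le_left _ _).trans hAδ) 1)
  have pow : ∀ x : ℝ≥0∞, x ≤ θ → x ^ (q / p) ≤ θ ^ (q / p - 1) * x := by
    intro x hx
    calc x ^ (q / p) = x ^ (q / p - 1) * x := by
          conv_rhs => rw [← ENNReal.rpow_one x, ← ENNReal.rpow_mul, one_mul]
          rw [← ENNReal.rpow_add_of_nonneg _ _ e.le zero_le_one]
          congr 1; ring
      _ ≤ _ := by gcongr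
  have hACθ : A ^ (q / p) + C ^ (q / p) ≤ θ ^ (q / p - 1) :=
    calc A ^ (q / p) + C ^ (q / p) ≤ θ ^ (q / p - 1) * A + θ ^ (q / p - 1) * C :=
          add_le_add (pow A hAθ) (pow C hCθ)
      _ = θ ^ (q / p - 1) * (A + C) := by ring
      _ ≤ θ ^ (q / p - 1) * 1 := by gcongr
      _ = _ := mul_one _
  calc lpSize q (corr K (F n))
      ≤ lpSize q (corr (core K M) (F n)) + lpSize q (corr (coreCompl K M) (F n)) :=
        lpSize_corr_le_core_add hq1 hK.measurable (hF.measurable n) M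
    _ ≤ (κ + b * (θ ^ (q / p - 1)) ^ (1 / q)) + κ := by
        refine add_le_add ?_ ?_
        · refine (hK.lpSize_corr_core_le_split (hF.measurable n) M ρ).trans (add_le_add ?_ ?_)
          · exact le_trans (by gcongr) hL
          · gcongr
        · refine (hK.lpSize_coreCompl_le (hF.measurable n) M).trans ?_
          rw [hF.lpSize_eq_one, mul_one]
          exact hM
    _ = _ := by ring

end Tightness

section WeakLimits

open scoped ENNReal

variable {p q s : ℝ} {K : ℝ → ℝ≥0∞} {b : ℝ≥0∞} {F : ℕ → ℝ → ℝ≥0∞}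

lemma eLpNorm_toReal_le_one {p : ℝ} (hp : 0 < p) {G : ℝ → ℝ≥0∞}
    (hG1 : ∫⁻ x, G x ^ p ≤ 1) :
    eLpNorm (fun x => (G x).toReal) (ENNReal.ofReal p) volume ≤ 1 := by
  rw [eLpNorm_eq_lintegral_rpow_enorm_toReal (by simpa using hp) ENNReal.ofReal_ne_top,
    ENNReal.toReal_ofReal hp.le]
  refine ENNReal.rpow_le_one (le_trans (lintegral_mono fun x => ?_) hG1) (by positivity)
  gcongr
  rw [Real.enorm_eq_ofReal ENNReal.toReal_nonneg]
  exact ENNReal.ofReal_toReal_le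

/-- A bounded sequence in `L^p` has a subsequence whose integrals against bounded, compactly
supported functions converge. -/
lemma exists_subseq_tendsto_lintegral_mul {p : ℝ} (hp : 1 < p) (hF : ∀ n, Measurable (F n))
    (hF1 : ∀ n, ∫⁻ x, F n x ^ p ≤ 1) :
    ∃ σ : ℕ → ℕ, StrictMono σ ∧ ∀ φ : ℝ → ℝ≥0∞, Measurable φ →
      (∃ a c C : ℝ, ∀ x, φ x ≤ (Icc a c).indicator (fun _ => ENNReal.ofReal C) x) →
      ∃ w : ℝ≥0∞, Tendsto (fun n => ∫⁻ x, φ x * F (σ n) x) atTop (𝓝 w) := by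
  have hp0 : 0 < p := by linarith
  have hconj := Real.HolderConjugate.conjExponent hp
  set p' := p.conjExponent with hp'
  have : ENNReal.HolderConjugate (ENNReal.ofReal p) (ENNReal.ofReal p') := hconj.ennrealOfReal
  have f1 : Fact (1 ≤ ENNReal.ofReal p) := ⟨by simpa using hp.le⟩
  have f2 : Fact (1 ≤ ENNReal.ofReal p') := ⟨by simpa using hconj.symm.lt.le⟩
  have f3 : Fact (ENNReal.ofReal p' ≠ ∞) := ⟨ENNReal.ofReal_ne_top⟩
  have hmem : ∀ n, MemLp (fun x => (F n x).toReal) (ENNReal.ofReal p) volume := fun n =>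
    ⟨(hF n).ennreal_toReal.aestronglyMeasurable,
      (eLpNorm_toReal_le_one hp0 (hF1 n)).trans_lt ENNReal.one_lt_top⟩
  let Λ := (ContinuousLinearMap.mul ℝ ℝ).lpPairing (volume : Measure ℝ)
    (ENNReal.ofReal p) (ENNReal.ofReal p')
  let x : ℕ → WeakDual ℝ (Lp ℝ (ENNReal.ofReal p') (volume : Measure ℝ)) := fun n =>
    StrongDual.toWeakDual (Λ ((hmem n).toLp _))
  have hx : ∀ n, x n ∈ WeakDual.toStrongDual ⁻¹' Metric.closedBall
      (0 : StrongDual ℝ (Lp ℝ (ENNReal.ofReal p') (volume : Measure ℝ))) ‖Λ‖ := by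
    intro n
    change Λ ((hmem n).toLp _) ∈ Metric.closedBall _ _
    rw [mem_closedBall_zero_iff]
    refine (Λ.le_opNorm _).trans (mul_le_of_le_one_right (norm_nonneg _) ?_)
    rw [Lp.norm_toLp]
    exact ENNReal.toReal_mono ENNReal.one_ne_top (eLpNorm_toReal_le_one hp0 (hF1 n))
  obtain ⟨ℓ, -, σ, hσ, hlim⟩ := WeakDual.isSeqCompact_closedBall ℝ _ _ _ hx
  refine ⟨σ, hσ, fun φ hφ ⟨a, c, C, hb⟩ => ?_⟩
  have hItop : ∀ x, (Icc a c).indicator (fun _ => ENNReal.ofReal C) x < ∞ := fun x => by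
    by_cases h : x ∈ Icc a c <;> simp [h, -mem_Icc]
  have hφtop : ∀ x, φ x < ∞ := fun x => (hb x).trans_lt (hItop x)
  have hφmem : MemLp (fun x => (φ x).toReal) (ENNReal.ofReal p') volume := by
    have hi : MemLp ((Icc a c).indicator (fun _ => max C 0)) (ENNReal.ofReal p') volume :=
      memLp_indicator_const _ measurableSet_Icc _ (Or.inr measure_Icc_lt_top.ne)
    refine hi.of_le hφ.ennreal_toReal.aestronglyMeasurable (ae_of_all _ fun x => ?_)
    rw [Real.norm_of_nonneg ENNReal.toReal_nonneg]
    refine le_trans ?_ (le_abs_self _)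
    have := ENNReal.toReal_mono ?_ (hb x)
    · refine this.trans (le_of_eq ?_)
      by_cases h : x ∈ Icc a c <;> simp [h, ENNReal.toReal_ofReal', -mem_Icc]
    · exact (hItop x).ne
  have hval : ∀ n, ∫⁻ x, φ x * F n x = ENNReal.ofReal (x n (hφmem.toLp _)) := by
    intro n
    have e : x n (hφmem.toLp _) = ∫ y, (F n y).toReal * (φ y).toReal := by
      change Λ ((hmem n).toLp _) (hφmem.toLp _) = _
      rw [ContinuousLinearMap.lpPairing_eq_integral]
      refine integral_congr_ae ?_
      filter_upwards [(hmem n).coeFn_toLp, hφmem.coeFn_toLp] with y h1 h2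
      simp [h1, h2]
    have hInt : Integrable (fun y => (F n y).toReal * (φ y).toReal) :=
      (hmem n).integrable_mul hφmem
    rw [e, ofReal_integral_eq_lintegral_ofReal hInt
      (ae_of_all _ fun y => mul_nonneg ENNReal.toReal_nonneg ENNReal.toReal_nonneg)]
    have hfin : ∀ᵐ y, F n y < ∞ := by
      filter_upwards [ae_lt_top ((hF n).pow_const p)
        ((hF1 n).trans_lt ENNReal.one_lt_top).ne] with y hy
      exact (ENNReal.rpow_lt_top_iff_of_pos hp0).1 hy
    refine lintegral_congr_ae ?_
    filter_upwards [hfin] with y hy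
    rw [ENNReal.ofReal_mul ENNReal.toReal_nonneg, ENNReal.ofReal_toReal hy.ne,
      ENNReal.ofReal_toReal (hφtop y).ne, mul_comm]
  refine ⟨ENNReal.ofReal (ℓ (hφmem.toLp _)), ?_⟩
  simp_rw [hval]
  exact (ENNReal.continuous_ofReal.tendsto _).comp
    (((WeakDual.eval_continuous (hφmem.toLp _)).tendsto ℓ).comp hlim)

lemma exists_subseq_tendsto_corr_core {p : ℝ} (hp : 1 < p) {K : ℝ → ℝ≥0∞} (hK : Measurable K)
    (hF : ∀ n, Measurable (F n)) (hF1 : ∀ n, ∫⁻ x, F n x ^ p ≤ 1) :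
    ∃ σ : ℕ → ℕ, StrictMono σ ∧ ∀ M t : ℝ,
      ∃ w : ℝ≥0∞, Tendsto (fun n => corr (core K M) (F (σ n)) t) atTop (𝓝 w) := by
  obtain ⟨σ, hσ, h⟩ := exists_subseq_tendsto_lintegral_mul hp hF hF1
  refine ⟨σ, hσ, fun M t => h (fun x => core K M (x - t))
    ((measurable_core hK M).comp (by fun_prop)) ⟨t - M, t + M, M, fun x => ?_⟩⟩
  refine (core_le_indicator K M _).trans (le_of_eq ?_)
  simp only [indicator, mem_Icc]
  congr 1
  apply propext
  constructor <;> rintro ⟨h1, h2⟩ <;> constructor <;> linarith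

lemma tendsto_lpSize_of_bounded {ι : Type*} {l : Filter ι} [l.IsCountablyGenerated] {q : ℝ}
    (hq : 0 < q) {V : ι → ℝ → ℝ≥0∞} {W : ℝ → ℝ≥0∞} (hV : ∀ i, Measurable (V i)) {R : ℝ} {C : ℝ≥0∞}
    (hC : C ≠ ∞) (hb : ∀ i t, V i t ≤ {t | |t| ≤ R}.indicator (fun _ => C) t)
    (hlim : ∀ t, Tendsto (fun i => V i t) l (𝓝 (W t))) :
    Tendsto (fun i => lpSize q (V i)) l (𝓝 (lpSize q W)) := by
  refine (ENNReal.continuous_rpow_const.tendsto _).comp ?_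
  refine tendsto_lintegral_filter_of_dominated_convergence
    (fun t => {t | |t| ≤ R}.indicator (fun _ => C) t ^ q)
    (Eventually.of_forall fun i => (hV i).pow_const q)
    (Eventually.of_forall fun i => ae_of_all _ fun t => ENNReal.rpow_le_rpow (hb i t) hq.le) ?_
    (ae_of_all _ fun t => (ENNReal.continuous_rpow_const.tendsto _).comp (hlim t))
  have : ∀ t, {t : ℝ | |t| ≤ R}.indicator (fun _ => C) t ^ q
      = {t : ℝ | |t| ≤ R}.indicator (fun _ => C ^ q) t := by
    intro t
    by_cases h : t ∈ {t : ℝ | |t| ≤ R} <;> simp only [indicator, h, if_true, if_false]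
    exact ENNReal.zero_rpow_of_pos hq
  simp_rw [this]
  rw [lintegral_indicator (measurableSet_abs_le R), setLIntegral_const]
  refine ENNReal.mul_ne_top (ENNReal.rpow_ne_top_of_nonneg hq.le hC) ?_
  have : {t : ℝ | |t| ≤ R} = Icc (-R) R := by
    ext t
    simp [abs_le]
  rw [this]
  exact measure_Icc_lt_top.ne

/-- For a tight extremizing sequence with weakly convergent images, the sums of two late terms are
again nearly extremal. -/
lemma CorrExtremizing.eventually_lt_lpSize_add (hK : YoungBound p q s K b)
    (hF : CorrExtremizing p q K b F)
    (htight : ∀ ε : ℝ≥0∞, 0 < ε →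
      ∃ R : ℝ, ∀ᶠ n in atTop, ∫⁻ x in {x | R < |x|}, F n x ^ p ≤ ε)
    (hweak : ∀ M t : ℝ, ∃ w : ℝ≥0∞, Tendsto (fun n => corr (core K M) (F n) t) atTop (𝓝 w))
    {γ : ℝ≥0∞} (hγ : γ < 2) :
    ∀ᶠ z : ℕ × ℕ in atTop ×ˢ atTop, γ < lpSize p (fun x => F z.1 x + F z.2 x) := by
  have hp0 : 0 < p := by linarith [hK.one_lt]
  have hq0 : 0 < q := by linarith [hK.lt]
  have hq1 : 1 ≤ q := by linarith [hK.lt, hK.one_lt]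
  have hbγ : b * γ < 2 * b := by
    rw [mul_comm 2 b, ENNReal.mul_lt_mul_iff_right hK.const_pos.ne' hK.const_ne_top]
    exact hγ
  obtain ⟨κ, hκ, hκb⟩ := exists_pos_add_add_lt hbγ
  set η := κ / 2 with hηdef
  have hη : 0 < η := ENNReal.half_pos hκ.ne'
  have hηκ : η + η = κ := ENNReal.add_halves κ
  obtain ⟨M, hM0, hM⟩ := exists_lpSize_coreCompl_le hK.measurable hK.pos hK.lintegral_ne_top hη
  obtain ⟨ε, hεη, hε⟩ : ∃ ε : ℝ≥0∞, b * ε ^ (1 / p) ≤ η ∧ 0 < ε := by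
    have c : Continuous (fun x : ℝ≥0∞ => b * x ^ (1 / p)) :=
      (ENNReal.continuous_const_mul hK.const_ne_top).comp ENNReal.continuous_rpow_const
    have lim := c.tendsto 0
    rw [ENNReal.zero_rpow_of_pos (by positivity), mul_zero] at lim
    exact (((lim.eventually (ge_mem_nhds hη)).filter_mono
      (nhdsWithin_le_nhds (s := Ioi 0))).and (eventually_mem_nhdsWithin)).exists
  obtain ⟨R, hR⟩ := htight ε hε
  set S := {t : ℝ | |t| ≤ R + M} with hS
  have mS : MeasurableSet S := measurableSet_abs_le _
  have hc := measurable_core hK.measurable M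
  choose w hw using hweak M
  set V : ℕ → ℝ → ℝ≥0∞ := fun n => S.indicator (corr (core K M) (F n)) with hV
  set W : ℝ → ℝ≥0∞ := S.indicator w with hW
  have mV : ∀ n, Measurable (V n) := fun n => (measurable_corr hc (hF.measurable n)).indicator mS
  have hVb : ∀ n t, V n t ≤ S.indicator (fun _ => coreConst p M) t := by
    intro n t
    refine indicator_le_indicator ?_
    refine (corr_core_le hK.one_lt.le K (hF.measurable n) M t).trans ?_
    refine mul_le_of_le_one_right zero_le (ENNReal.rpow_le_one ?_ (by positivity))
    exact (setLIntegral_le_lintegral _ _).trans (hF.norm_eq n).le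
  have hVW : ∀ t, Tendsto (fun n => V n t) atTop (𝓝 (W t)) := by
    intro t
    by_cases ht : t ∈ S
    · simpa only [hV, hW, indicator_of_mem ht] using hw t
    · simpa only [hV, hW, indicator_of_notMem ht] using tendsto_const_nhds
  have mW : Measurable W := measurable_of_tendsto_metrizable mV (tendsto_pi_nhds.2 hVW)
  have lim1 : Tendsto (fun n => lpSize q (V n)) atTop (𝓝 (lpSize q W)) :=
    tendsto_lpSize_of_bounded hq0 mV (coreConst_ne_top hK.one_lt.le M) hVb hVW
  have lim2 : Tendsto (fun z : ℕ × ℕ => lpSize q (fun t => V z.1 t + V z.2 t)) (atTop ×ˢ atTop)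
      (𝓝 (2 * lpSize q W)) := by
    rw [← lpSize_const_mul hq0 _ mW]
    refine tendsto_lpSize_of_bounded hq0 (fun z => (mV _).add (mV _))
      (C := coreConst p M + coreConst p M) (R := R + M) (by
        have := coreConst_ne_top hK.one_lt.le M
        finiteness) (fun z t => ?_) fun t => ?_
    · refine (add_le_add (hVb z.1 t) (hVb z.2 t)).trans (le_of_eq ?_)
      by_cases ht : t ∈ S
      · rw [indicator_of_mem ht, indicator_of_mem ht]
      · rw [indicator_of_notMem ht, indicator_of_notMem ht, add_zero]
    · rw [two_mul]
      exact ((hVW t).comp tendsto_fst).add ((hVW t).comp tendsto_snd)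
  have hbW : b ≤ lpSize q W + κ := by
    refine le_of_tendsto_of_tendsto hF.tendsto (lim1.add_const κ) ?_
    filter_upwards [hR] with n hn
    have mI := (hF.measurable n).indicator (measurableSet_lt_abs R)
    have split : ∀ t, corr (core K M) (F n) t ≤
        V n t + corr (core K M) ({x | R < |x|}.indicator (F n)) t := by
      intro t
      by_cases ht : t ∈ S
      · simp only [hV, indicator_of_mem ht]
        exact le_self_add
      · refine le_trans (lintegral_mono fun x => ?_) le_add_self
        by_cases hx : x ∈ {x : ℝ | R < |x|}
        · rw [indicator_of_mem hx]
        · have h1 : |x| ≤ R := not_lt.1 hx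
          have h2 : R + M < |t| := not_le.1 ht
          have h3 := abs_sub_abs_le_abs_sub t x
          rw [abs_sub_comm] at h3
          rw [core_eq_zero (by linarith), zero_mul, zero_mul]
    calc lpSize q (corr K (F n))
        ≤ lpSize q (corr (core K M) (F n)) + lpSize q (corr (coreCompl K M) (F n)) :=
          lpSize_corr_le_core_add hq1 hK.measurable (hF.measurable n) M
      _ ≤ (lpSize q (V n) + η) + η := by
          refine add_le_add ?_ ?_
          · refine (lpSize_mono hq0 split).trans ((lpSize_add_le hq1 (mV n)
              (measurable_corr hc mI)).trans (add_le_add le_rfl ?_))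
            refine (hK.lpSize_core_le mI M).trans ?_
            rw [lpSize_indicator hp0 _ (measurableSet_lt_abs R)]
            exact le_trans (by gcongr) hεη
          · refine (hK.lpSize_coreCompl_le (hF.measurable n) M).trans ?_
            rw [hF.lpSize_eq_one, mul_one]
            exact hM
      _ = lpSize q (V n) + κ := by rw [add_assoc, hηκ]
  have hlt : b * γ < 2 * lpSize q W := by
    have h1 : b * γ + κ + κ < 2 * lpSize q W + κ + κ := by
      refine hκb.trans_le ((mul_le_mul_right hbW 2).trans (le_of_eq (by ring)))
    exact lt_of_add_lt_add_right (lt_of_add_lt_add_right h1)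
  filter_upwards [lim2.eventually (lt_mem_nhds hlt)] with z hz
  have hsum : ∀ t, V z.1 t + V z.2 t ≤ corr K (fun x => F z.1 x + F z.2 x) t := by
    intro t
    rw [corr_add hK.measurable (hF.measurable _)]
    exact add_le_add
      ((indicator_le_self _ _ _).trans (corr_mono (core_le K M) (fun _ => le_rfl) t))
      ((indicator_le_self _ _ _).trans (corr_mono (core_le K M) (fun _ => le_rfl) t))
  have := hz.trans_le ((lpSize_mono hq0 hsum).trans
    (hK.bound _ ((hF.measurable _).add (hF.measurable _))))
  rwa [ENNReal.mul_lt_mul_iff_right hK.const_pos.ne' hK.const_ne_top] at this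

end WeakLimits

section UniformConvexity

open scoped ENNReal

variable {p q s : ℝ} {K : ℝ → ℝ≥0∞} {b : ℝ≥0∞}

/-- Strict convexity of `x ↦ x ^ p` in quantitative form, on the unit simplex. -/
lemma exists_abs_sub_rpow_le_unit (hp : 1 < p) {ε : ℝ} (hε : 0 < ε) :
    ∃ C : ℝ, 0 ≤ C ∧ ∀ x ∈ Icc (0 : ℝ) 1, |x - (1 - x)| ^ p ≤ ε * (x ^ p + (1 - x) ^ p)
      + C * ((x ^ p + (1 - x) ^ p) / 2 - ((1 : ℝ) / 2) ^ p) := by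
  have hp0 : 0 < p := by linarith
  set h : ℝ → ℝ := fun x => (x ^ p + (1 - x) ^ p) / 2 - ((1 : ℝ) / 2) ^ p with hh
  set g : ℝ → ℝ := fun x => |x - (1 - x)| ^ p - ε * (x ^ p + (1 - x) ^ p) with hg
  have ch : Continuous h := by
    have c1 : Continuous fun x : ℝ => x ^ p := Real.continuous_rpow_const hp0.le
    have c2 : Continuous fun x : ℝ => (1 - x) ^ p := c1.comp (by fun_prop)
    fun_prop
  have cg : Continuous g := by
    have c1 : Continuous fun x : ℝ => x ^ p := Real.continuous_rpow_const hp0.le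
    have c2 : Continuous fun x : ℝ => (1 - x) ^ p := c1.comp (by fun_prop)
    have c3 : Continuous fun x : ℝ => |x - (1 - x)| ^ p := c1.comp (by fun_prop)
    fun_prop
  have hpos : ∀ x ∈ Icc (0 : ℝ) 1, x ≠ 1 / 2 → 0 < h x := by
    intro x hx hne
    have hx1 : x ∈ Ici (0 : ℝ) := hx.1
    have hx2 : 1 - x ∈ Ici (0 : ℝ) := sub_nonneg.2 hx.2
    have hx3 : x ≠ 1 - x := fun h => hne (by linarith)
    have := (strictConvexOn_rpow hp).2 hx1 hx2 hx3 (one_half_pos (α := ℝ))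
      (one_half_pos (α := ℝ)) (add_halves (1 : ℝ))
    simp only [smul_eq_mul] at this
    rw [show (1 : ℝ) / 2 * x + 1 / 2 * (1 - x) = 1 / 2 by ring] at this
    simp only [hh]
    linarith
  have hnn : ∀ x ∈ Icc (0 : ℝ) 1, 0 ≤ h x := by
    intro x hx
    by_cases hne : x = 1 / 2
    · have : h x = 0 := by simp only [hh, hne]; norm_num
      exact this.ge
    · exact (hpos x hx hne).le
  have hg1 : ∀ x ∈ Icc (0 : ℝ) 1, g x ≤ 1 := by
    intro x hx
    have h1 : |x - (1 - x)| ^ p ≤ 1 := by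
      refine Real.rpow_le_one (abs_nonneg _) ?_ hp0.le
      rw [abs_le]; constructor <;> linarith [hx.1, hx.2]
    have h2 : 0 ≤ ε * (x ^ p + (1 - x) ^ p) :=
      mul_nonneg hε.le (add_nonneg (Real.rpow_nonneg hx.1 _)
        (Real.rpow_nonneg (by linarith [hx.2]) _))
    simp only [hg]
    linarith
  suffices ∃ C : ℝ, 0 ≤ C ∧ ∀ x ∈ Icc (0 : ℝ) 1, g x ≤ C * h x by
    obtain ⟨C, hC, H⟩ := this
    refine ⟨C, hC, fun x hx => ?_⟩
    have := H x hx
    simp only [hg, hh] at this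
    linarith
  set S := Icc (0 : ℝ) 1 ∩ {x | 0 ≤ g x} with hS
  have cS : IsCompact S := isCompact_Icc.inter_right (isClosed_le continuous_const cg)
  rcases S.eq_empty_or_nonempty with hE | hE
  · refine ⟨0, le_rfl, fun x hx => ?_⟩
    by_contra! hcon
    have : x ∈ S := ⟨hx, by
      have : 0 < g x := by simpa using hcon
      exact this.le⟩
    simp [hE] at this
  · obtain ⟨x₀, hx₀, hmin⟩ := cS.exists_isMinOn hE ch.continuousOn
    have hne : x₀ ≠ 1 / 2 := by
      intro h0
      have h1 : 0 ≤ g x₀ := hx₀.2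
      simp only [hg, h0] at h1
      norm_num at h1
      rw [Real.zero_rpow hp0.ne'] at h1
      have : 0 < ε * ((1 / 2 : ℝ) ^ p + (1 / 2 : ℝ) ^ p) := by positivity
      linarith
    have hm := hpos x₀ hx₀.1 hne
    refine ⟨1 / h x₀, by positivity, fun x hx => ?_⟩
    by_cases hx' : 0 ≤ g x
    · have h1 : h x₀ ≤ h x := hmin ⟨hx, hx'⟩
      calc g x ≤ 1 := hg1 x hx
        _ ≤ h x / h x₀ := by rwa [one_le_div hm]
        _ = _ := by ring
    · exact (not_le.1 hx').le.trans (mul_nonneg (by positivity) (hnn x hx))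

lemma exists_abs_sub_rpow_le (hp : 1 < p) {ε : ℝ} (hε : 0 < ε) :
    ∃ C : ℝ, 0 ≤ C ∧ ∀ x y : ℝ, 0 ≤ x → 0 ≤ y → |x - y| ^ p + C * ((x + y) / 2) ^ p ≤
      ε * (x ^ p + y ^ p) + C * ((x ^ p + y ^ p) / 2) := by
  have hp0 : 0 < p := by linarith
  obtain ⟨C, hC, H⟩ := exists_abs_sub_rpow_le_unit hp hε
  refine ⟨C, hC, fun x y hx hy => ?_⟩
  rcases (add_nonneg hx hy).eq_or_lt with h0 | h0
  · have hx0 : x = 0 := by linarith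
    have hy0 : y = 0 := by linarith
    simp [hx0, hy0, Real.zero_rpow hp0.ne']
  · set S := x + y with hS
    have hu : x / S ∈ Icc (0 : ℝ) 1 := ⟨by positivity, by rw [div_le_one h0]; linarith⟩
    have e1 : 1 - x / S = y / S := by field_simp; linarith
    have := H _ hu
    rw [e1, ← sub_div, abs_div, abs_of_pos h0, Real.div_rpow (abs_nonneg _) h0.le,
      Real.div_rpow hx h0.le, Real.div_rpow hy h0.le] at this
    have hSp : 0 < S ^ p := by positivity
    have m := mul_le_mul_of_nonneg_left this hSp.le
    rw [Real.div_rpow h0.le zero_le_two]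
    rw [Real.div_rpow zero_le_one zero_le_two, Real.one_rpow] at m
    have l : S ^ p * (|x - y| ^ p / S ^ p) = |x - y| ^ p := by field_simp
    have r : S ^ p * (ε * (x ^ p / S ^ p + y ^ p / S ^ p)
        + C * ((x ^ p / S ^ p + y ^ p / S ^ p) / 2 - 1 / 2 ^ p))
        = ε * (x ^ p + y ^ p) + C * ((x ^ p + y ^ p) / 2) - C * (S ^ p / 2 ^ p) := by
      field_simp
      ring
    rw [l, r] at m
    linarith

/-- Uniform convexity of `L^p`: if the norms of sums of two late terms of a normalized sequence of
nonnegative functions tend to `2`, the sequence is Cauchy. -/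
lemma tendsto_lintegral_abs_sub_rpow (hp : 1 < p) {f : ℕ → ℝ → ℝ} (hf : ∀ n, Measurable (f n))
    (hf0 : ∀ n x, 0 ≤ f n x) (hf1 : ∀ n, ∫⁻ x, ENNReal.ofReal (f n x) ^ p = 1)
    (hsum : ∀ γ : ℝ≥0∞, γ < 2 → ∀ᶠ z : ℕ × ℕ in atTop ×ˢ atTop,
      γ < lpSize p (fun x => ENNReal.ofReal (f z.1 x) + ENNReal.ofReal (f z.2 x))) :
    Tendsto (fun z : ℕ × ℕ => ∫⁻ x, ENNReal.ofReal |f z.1 x - f z.2 x| ^ p) (atTop ×ˢ atTop)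
      (𝓝 0) := by
  have hp0 : 0 < p := by linarith
  rw [ENNReal.tendsto_nhds_zero]
  intro ε hε
  obtain ⟨e, he0, heε⟩ : ∃ e : ℝ, 0 < e ∧ ENNReal.ofReal (3 * e) ≤ ε := by
    obtain ⟨r, hr0, hr⟩ := ENNReal.lt_iff_exists_nnreal_btwn.1 hε
    refine ⟨r / 3, by have : (0 : ℝ) < r := by exact_mod_cast hr0
                      positivity, ?_⟩
    rw [mul_div_cancel₀ _ (by norm_num), ENNReal.ofReal_coe_nnreal]
    exact hr.le
  obtain ⟨C, hC, H⟩ := exists_abs_sub_rpow_le hp he0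
  obtain ⟨γ, hγ, hγ2⟩ : ∃ γ : ℝ≥0∞, ENNReal.ofReal C <
      ENNReal.ofReal C * (γ / 2) ^ p + ENNReal.ofReal e ∧ γ < 2 := by
    have c : Continuous fun γ : ℝ≥0∞ => ENNReal.ofReal C * (γ / 2) ^ p + ENNReal.ofReal e :=
      ((ENNReal.continuous_const_mul ENNReal.ofReal_ne_top).comp
        (ENNReal.continuous_rpow_const.comp (ENNReal.continuous_div_const 2 two_ne_zero))).add
        continuous_const
    have lim := c.tendsto 2
    rw [ENNReal.div_self two_ne_zero ENNReal.ofNat_ne_top, ENNReal.one_rpow, mul_one] at lim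
    have hlt : ENNReal.ofReal C < ENNReal.ofReal C + ENNReal.ofReal e :=
      ENNReal.lt_add_right ENNReal.ofReal_ne_top (by simpa using he0)
    have : (𝓝[<] (2 : ℝ≥0∞)).NeBot := nhdsLT_neBot_of_exists_lt ⟨0, by norm_num⟩
    exact (((lim.eventually (lt_mem_nhds hlt)).filter_mono
      (nhdsWithin_le_nhds (s := Iio 2))).and (eventually_mem_nhdsWithin)).exists
  filter_upwards [hsum γ hγ2] with z hz
  set u := f z.1
  set v := f z.2
  set Y := ∫⁻ x, ((ENNReal.ofReal (u x) + ENNReal.ofReal (v x)) / 2) ^ p with hY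
  have mu' : Measurable fun x => ENNReal.ofReal (u x) := (hf z.1).ennreal_ofReal
  have mv' : Measurable fun x => ENNReal.ofReal (v x) := (hf z.2).ennreal_ofReal
  have hYeq : Y = (lpSize p (fun x => ENNReal.ofReal (u x) + ENNReal.ofReal (v x)) / 2) ^ p := by
    rw [hY, ← lpSize_rpow hp0]
    congr 1
    simp_rw [div_eq_mul_inv, mul_comm _ (2 : ℝ≥0∞)⁻¹]
    exact lpSize_const_mul hp0 _ (mu'.add mv')
  have hYtop : Y ≠ ∞ := by
    rw [hYeq]
    refine ENNReal.rpow_ne_top_of_nonneg hp0.le (ENNReal.div_ne_top ?_ two_ne_zero)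
    refine ((lpSize_add_le hp.le mu' mv').trans_lt ?_).ne
    have h1 : lpSize p (fun x => ENNReal.ofReal (u x)) = 1 := by rw [lpSize, hf1, ENNReal.one_rpow]
    have h2 : lpSize p (fun x => ENNReal.ofReal (v x)) = 1 := by rw [lpSize, hf1, ENNReal.one_rpow]
    rw [h1, h2]
    finiteness
  have hpt : ∀ x, ENNReal.ofReal |u x - v x| ^ p
        + ENNReal.ofReal C * ((ENNReal.ofReal (u x) + ENNReal.ofReal (v x)) / 2) ^ p
      ≤ ENNReal.ofReal (e + C / 2) * (ENNReal.ofReal (u x) ^ p + ENNReal.ofReal (v x) ^ p) := by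
    intro x
    have hu := hf0 z.1 x
    have hv := hf0 z.2 x
    have h2 : (2 : ℝ≥0∞) = ENNReal.ofReal 2 := by simp
    rw [← ENNReal.ofReal_add hu hv, h2, ← ENNReal.ofReal_div_of_pos two_pos,
      ENNReal.ofReal_rpow_of_nonneg (abs_nonneg _) hp0.le,
      ENNReal.ofReal_rpow_of_nonneg (by positivity) hp0.le,
      ENNReal.ofReal_rpow_of_nonneg hu hp0.le, ENNReal.ofReal_rpow_of_nonneg hv hp0.le,
      ← ENNReal.ofReal_mul hC, ← ENNReal.ofReal_add (by positivity) (by positivity),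
      ← ENNReal.ofReal_add (by positivity) (by positivity), ← ENNReal.ofReal_mul (by positivity)]
    refine ENNReal.ofReal_le_ofReal ((H _ _ hu hv).trans (le_of_eq ?_))
    ring
  have hInt := lintegral_mono (μ := (volume : Measure ℝ)) hpt
  rw [lintegral_add_right _ (by fun_prop), lintegral_const_mul' _ _ ENNReal.ofReal_ne_top,
    lintegral_const_mul' _ _ ENNReal.ofReal_ne_top, lintegral_add_left (by fun_prop), hf1, hf1,
    ← hY] at hInt
  have hYγ : (γ / 2) ^ p ≤ Y := by
    rw [hYeq]
    gcongr
  have hfin : ENNReal.ofReal C * Y ≠ ∞ := ENNReal.mul_ne_top ENNReal.ofReal_ne_top hYtop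
  refine le_trans ?_ heε
  rw [← ENNReal.add_le_add_iff_right hfin]
  calc _ ≤ _ := hInt
    _ = ENNReal.ofReal (2 * e) + ENNReal.ofReal C := by
        rw [← ENNReal.ofReal_add (by positivity) hC,
          show (1 : ℝ≥0∞) + 1 = ENNReal.ofReal 2 by rw [ENNReal.ofReal_ofNat]; norm_num,
          ← ENNReal.ofReal_mul (by positivity)]
        congr 1; ring
    _ ≤ ENNReal.ofReal (2 * e) + (ENNReal.ofReal C * Y + ENNReal.ofReal e) := by
        gcongr
        exact hγ.le.trans (by gcongr)
    _ = ENNReal.ofReal (3 * e) + ENNReal.ofReal C * Y := by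
        rw [show 3 * e = 2 * e + e by ring, ENNReal.ofReal_add (by positivity) he0.le]
        ring

/-- Extremizing sequences for correlation with `K` are precompact modulo translations. -/
lemma CorrExtremizing.exists_cauchy_translates (hK : YoungBound p q s K b) {f : ℕ → ℝ → ℝ}
    (hf : ∀ n, Measurable (f n)) (hf0 : ∀ n x, 0 ≤ f n x)
    (hF : CorrExtremizing p q K b (fun n x => ENNReal.ofReal (f n x))) :
    ∃ σ : ℕ → ℕ, StrictMono σ ∧ ∃ τ : ℕ → ℝ,
      Tendsto (fun z : ℕ × ℕ => ∫⁻ x, ENNReal.ofReal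
        |f (σ z.1) (x + τ z.1) - f (σ z.2) (x + τ z.2)| ^ p) (atTop ×ˢ atTop) (𝓝 0) := by
  obtain ⟨M, δ, hδ, τ, hw⟩ := hF.exists_window hK
  have hT := hF.translate τ
  obtain ⟨σ, hσ, hweak⟩ := exists_subseq_tendsto_corr_core hK.one_lt hK.measurable hT.measurable
    (fun n => (hT.norm_eq n).le)
  have hS := hT.subseq hσ
  refine ⟨σ, hσ, fun n => τ (σ n), ?_⟩
  refine tendsto_lintegral_abs_sub_rpow (f := fun n x => f (σ n) (x + τ (σ n))) hK.one_lt
    (fun n => (hf _).comp (by fun_prop)) (fun _ _ => hf0 _ _) hS.norm_eq fun γ hγ => ?_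
  exact hS.eventually_lt_lpSize_add hK
    (fun ε hε => hS.tight hK hδ (hσ.tendsto_atTop.eventually hw) hε) hweak hγ

end UniformConvexity

section LogCoordinates

open scoped ENNReal

variable {p : ℝ} {d k : ℕ}

lemma lintegral_Ioi_zero_eq_lintegral_exp (g : ℝ → ℝ≥0∞) :
    ∫⁻ r in Ioi (0 : ℝ), g r = ∫⁻ t, ENNReal.ofReal (Real.exp t) * g (Real.exp t) := by
  have h := lintegral_image_eq_lintegral_abs_deriv_mul (s := univ) (f := Real.exp)
    (f' := Real.exp) MeasurableSet.univ (fun x _ => (Real.hasDerivAt_exp x).hasDerivWithinAt)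
    Real.exp_injective.injOn g
  rw [image_univ, Real.range_exp] at h
  simpa [abs_of_pos, Real.exp_pos] using h

lemma lintegral_Ioi_exp_eq_lintegral_exp (g : ℝ → ℝ≥0∞) (t : ℝ) :
    ∫⁻ r in Ioi (Real.exp t), g r
      = ∫⁻ x in Ioi t, ENNReal.ofReal (Real.exp x) * g (Real.exp x) := by
  have h := lintegral_image_eq_lintegral_abs_deriv_mul (s := Ioi t) (f := Real.exp)
    (f' := Real.exp) measurableSet_Ioi (fun x _ => (Real.hasDerivAt_exp x).hasDerivWithinAt)
    Real.exp_injective.injOn g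
  have himg : Real.exp '' Ioi t = Ioi (Real.exp t) := by
    ext y
    constructor
    · rintro ⟨x, hx, rfl⟩
      exact Real.exp_lt_exp.2 hx
    · intro hy
      have hy0 : 0 < y := (Real.exp_pos t).trans hy
      exact ⟨Real.log y, (Real.lt_log_iff_exp_lt hy0).2 hy, Real.exp_log hy0⟩
  rw [himg] at h
  simpa [abs_of_pos, Real.exp_pos] using h

/-- The norm of `L^p(r^m dr)` in logarithmic coordinates. -/
lemma eLpNorm_withDensity_pow (hp : 0 < p) (m : ℕ) (f : ℝ → ℝ) :
    eLpNorm f (ENNReal.ofReal p)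
        ((volume.restrict (Ioi (0 : ℝ))).withDensity (fun r => ENNReal.ofReal (r ^ m)))
      = lpSize p (fun t => ENNReal.ofReal (|f (Real.exp t)| * Real.exp (t * ((m + 1) / p)))) := by
  rw [eLpNorm_eq_lintegral_rpow_enorm_toReal (by simpa using hp) ENNReal.ofReal_ne_top,
    ENNReal.toReal_ofReal hp.le, lintegral_withDensity_eq_lintegral_mul_non_measurable _
      (by fun_prop) (Eventually.of_forall fun _ => ENNReal.ofReal_lt_top),
    lintegral_Ioi_zero_eq_lintegral_exp, lpSize]
  congr 2
  ext t
  rw [Pi.mul_apply, Real.enorm_eq_ofReal_abs, ENNReal.ofReal_rpow_of_nonneg (abs_nonneg _) hp.le,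
    ENNReal.ofReal_rpow_of_nonneg (by positivity) hp.le, ← ENNReal.ofReal_mul (by positivity),
    ← ENNReal.ofReal_mul (by positivity), Real.mul_rpow (abs_nonneg _) (by positivity),
    ← Real.exp_mul, ← Real.exp_nat_mul, ← mul_assoc, ← Real.exp_add, mul_comm]
  congr 3
  field_simp
  ring

lemma eLpNorm_mu (hp : 0 < p) (hd : 1 ≤ d) (f : ℝ → ℝ) :
    eLpNorm f (ENNReal.ofReal p) (mu d)
      = lpSize p (fun t => ENNReal.ofReal (|f (Real.exp t)| * Real.exp (t * (d / p)))) := by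
  rw [mu, eLpNorm_withDensity_pow hp]
  simp [Nat.cast_sub hd]

lemma eLpNorm_nu (hp : 0 < p) (hkd : k + 1 ≤ d) (f : ℝ → ℝ) :
    eLpNorm f (ENNReal.ofReal p) (nu d k)
      = lpSize p (fun t => ENNReal.ofReal (|f (Real.exp t)| * Real.exp (t * ((d - k) / p)))) := by
  rw [nu, eLpNorm_withDensity_pow hp]
  have : ((d - k - 1 : ℕ) : ℝ) + 1 = d - k := by
    rw [Nat.sub_sub, Nat.cast_sub hkd]
    push_cast
    ring
  rw [this]

/-- The kernel of the operator `T` in logarithmic coordinates. -/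
def logKernel (d k : ℕ) (x : ℝ) : ℝ≥0∞ :=
  (Ioi (0 : ℝ)).indicator (fun x => ENNReal.ofReal
    (Real.exp (-(((d : ℝ) - k) / (d + 1)) * x) *
      (1 - Real.exp (-(2 * x))) ^ ((k : ℝ) / 2 - 1))) x

lemma measurable_logKernel (d k : ℕ) : Measurable (logKernel d k) :=
  Measurable.indicator (by fun_prop) measurableSet_Ioi

lemma one_sub_exp_rpow_le {x β : ℝ} (hx : 0 < x) (hβ : -1 < β) :
    (1 - Real.exp (-(2 * x))) ^ β ≤ 1 + (2 * x) ^ β := by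
  have h1 : Real.exp (-(2 * x)) < 1 := by
    rw [Real.exp_lt_one_iff]
    linarith
  rcases le_total 0 β with h | h
  · have := Real.rpow_le_one (by linarith) (by linarith [Real.exp_pos (-(2 * x))] :
      1 - Real.exp (-(2 * x)) ≤ 1) h
    have := Real.rpow_nonneg (by linarith : 0 ≤ 2 * x) β
    linarith
  · have hlow : 2 * x / (1 + 2 * x) ≤ 1 - Real.exp (-(2 * x)) := by
      have h2 : Real.exp (-(2 * x)) ≤ 1 / (1 + 2 * x) := by
        rw [Real.exp_neg, ← one_div]
        exact one_div_le_one_div_of_le (by linarith) (by linarith [Real.add_one_le_exp (2 * x)])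
      have h3 : 2 * x / (1 + 2 * x) = 1 - 1 / (1 + 2 * x) := by field_simp; ring
      linarith
    calc _ ≤ (2 * x / (1 + 2 * x)) ^ β :=
          Real.rpow_le_rpow_of_nonpos (by positivity) hlow h
      _ = (1 + (2 * x)⁻¹) ^ (-β) := by
          rw [Real.rpow_neg (by positivity), ← Real.inv_rpow (by positivity)]
          congr 1
          field_simp
          ring
      _ ≤ 1 ^ (-β) + ((2 * x)⁻¹) ^ (-β) :=
          Real.rpow_add_le_add_rpow zero_le_one (by positivity) (by linarith) (by linarith)
      _ = _ := by
          rw [Real.one_rpow, Real.rpow_neg (by positivity), Real.inv_rpow (by positivity), inv_inv]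

lemma lintegral_logKernel_rpow_ne_top (hk : 1 ≤ k) (hkd : k + 1 ≤ d) :
    ∫⁻ x, logKernel d k x ^ (((d : ℝ) + 1) / (d + 1 - k)) ≠ ∞ := by
  have hk' : (1 : ℝ) ≤ k := by exact_mod_cast hk
  have hkd' : (k : ℝ) + 1 ≤ d := by exact_mod_cast hkd
  set s : ℝ := ((d : ℝ) + 1) / (d + 1 - k) with hs
  have hs0 : 0 < s := div_pos (by linarith) (by linarith)
  set a : ℝ := ((d : ℝ) - k) / (d + 1) with ha
  have ha0 : 0 < a := div_pos (by linarith) (by linarith)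
  set β : ℝ := ((k : ℝ) / 2 - 1) * s with hβ
  have hβ1 : -1 < β := by
    have h0 : (0 : ℝ) < d + 1 - k := by linarith
    rw [hβ, hs, ← mul_div_assoc, lt_div_iff₀ h0]
    nlinarith
  have hI : IntegrableOn (fun x : ℝ => Real.exp (-(a * s) * x) + 2 ^ β *
      (x ^ β * Real.exp (-(a * s) * x))) (Ioi 0) := by
    have h1 := integrableOn_rpow_mul_exp_neg_mul_rpow (s := 0) (p := 1) (b := a * s)
      (by norm_num) one_pos (by positivity)
    have h2 := integrableOn_rpow_mul_exp_neg_mul_rpow (s := β) (p := 1) (b := a * s)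
      hβ1 one_pos (by positivity)
    simp only [Real.rpow_zero, one_mul, Real.rpow_one] at h1 h2
    exact h1.add (h2.const_mul _)
  refine (lt_of_le_of_lt ?_ hI.lintegral_lt_top).ne
  rw [← lintegral_indicator measurableSet_Ioi]
  refine lintegral_mono fun x => ?_
  by_cases hx : x ∈ Ioi (0 : ℝ)
  · have hx0 : 0 < x := hx
    have h1 : 0 ≤ 1 - Real.exp (-(2 * x)) := by
      rw [sub_nonneg, Real.exp_le_one_iff]
      linarith
    rw [logKernel, indicator_of_mem hx, indicator_of_mem hx,
      ENNReal.ofReal_rpow_of_nonneg (by positivity) hs0.le,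
      Real.mul_rpow (by positivity) (by positivity), ← Real.rpow_mul h1, ← Real.exp_mul]
    refine ENNReal.ofReal_le_ofReal ?_
    have h2 := one_sub_exp_rpow_le hx0 hβ1
    rw [Real.mul_rpow zero_le_two hx0.le] at h2
    calc _ ≤ Real.exp (-a * x * s) * (1 + 2 ^ β * x ^ β) := by gcongr
      _ = _ := by
        rw [show -a * x * s = -(a * s) * x by ring]
        ring
  · rw [logKernel, indicator_of_notMem hx, indicator_of_notMem hx, ENNReal.zero_rpow_of_pos hs0]

/-- The profile of a function in logarithmic coordinates, scaled so that its `L^p` norm is that of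
`L^p(r^(d-1) dr)`. -/
def logProfile (d k : ℕ) (f : ℝ → ℝ) (t : ℝ) : ℝ :=
  f (Real.exp t) * Real.exp (t * (d / pExp d k))

lemma measurable_logProfile {f : ℝ → ℝ} (hf : Measurable f) : Measurable (logProfile d k f) := by
  unfold logProfile
  fun_prop

lemma logProfile_nonneg {f : ℝ → ℝ} (hf : ∀ r, 0 ≤ f r) (t : ℝ) : 0 ≤ logProfile d k f t :=
  mul_nonneg (hf _) (Real.exp_pos _).le

lemma lintegral_Ioi_exp_eq_corr (f : ℝ → ℝ) (t : ℝ) :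
    ENNReal.ofReal (Real.exp (t * ((d - k) / qExp d))) *
        ∫⁻ u in Ioi (Real.exp t),
          ENNReal.ofReal (f u * (u ^ 2 - Real.exp t ^ 2) ^ ((k : ℝ) / 2 - 1) * u)
      = corr (logKernel d k) (fun x => ENNReal.ofReal (logProfile d k f x)) t := by
  rw [lintegral_Ioi_exp_eq_lintegral_exp, ← lintegral_const_mul' _ _ ENNReal.ofReal_ne_top,
    ← lintegral_indicator measurableSet_Ioi, corr]
  congr 1
  ext x
  by_cases hx : x ∈ Ioi t
  · have hx0 : 0 < x - t := sub_pos.2 hx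
    have h1 : 0 ≤ 1 - Real.exp (-(2 * (x - t))) := by
      rw [sub_nonneg, Real.exp_le_one_iff]
      linarith
    have hsq : Real.exp x ^ 2 - Real.exp t ^ 2
        = Real.exp (2 * x) * (1 - Real.exp (-(2 * (x - t)))) := by
      rw [mul_sub, ← Real.exp_add, ← Real.exp_nat_mul, ← Real.exp_nat_mul]
      push_cast
      ring_nf
    rw [indicator_of_mem hx, logKernel, indicator_of_mem (show x - t ∈ Ioi (0 : ℝ) from hx0),
      hsq, Real.mul_rpow (by positivity) h1, logProfile, ← Real.exp_mul,
      ← ENNReal.ofReal_mul (by positivity), ← ENNReal.ofReal_mul (by positivity),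
      ← ENNReal.ofReal_mul (by positivity)]
    congr 1
    have hexp : Real.exp (t * ((d - k) / qExp d)) * (Real.exp x * (Real.exp (2 * x * (k / 2 - 1)) *
        Real.exp x)) = Real.exp (-(((d : ℝ) - k) / (d + 1)) * (x - t)) *
          Real.exp (x * (d / pExp d k)) := by
      simp only [← Real.exp_add, pExp, qExp]
      congr 1
      field_simp
      ring
    linear_combination (f (Real.exp x) *
      (1 - Real.exp (-(2 * (x - t)))) ^ ((k : ℝ) / 2 - 1)) * hexp
  · have hx0 : x - t ∉ Ioi (0 : ℝ) := by simpa using hx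
    rw [indicator_of_notMem hx, logKernel, indicator_of_notMem hx0, zero_mul]

lemma T_eq_toReal_lintegral {f : ℝ → ℝ} (hf : Measurable f) (hf0 : ∀ r, 0 ≤ f r) {r : ℝ}
    (hr : 0 ≤ r) :
    T k f r = (∫⁻ u in Ioi r,
      ENNReal.ofReal (f u * (u ^ 2 - r ^ 2) ^ ((k : ℝ) / 2 - 1) * u)).toReal := by
  rw [T, integral_eq_lintegral_of_nonneg_ae]
  · filter_upwards [ae_restrict_mem measurableSet_Ioi] with u hu
    have hu' : r < u := hu
    have h0 : 0 ≤ u := hr.trans hu'.le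
    have h1 : 0 ≤ u ^ 2 - r ^ 2 := by nlinarith
    exact mul_nonneg (mul_nonneg (hf0 u) (Real.rpow_nonneg h1 _)) h0
  · exact Measurable.aestronglyMeasurable (by fun_prop)

lemma ofReal_abs_T_mul_exp {f : ℝ → ℝ} (hf : Measurable f) (hf0 : ∀ r, 0 ≤ f r) {t : ℝ}
    (h : corr (logKernel d k) (fun x => ENNReal.ofReal (logProfile d k f x)) t ≠ ∞) :
    ENNReal.ofReal (|T k f (Real.exp t)| * Real.exp (t * ((d - k) / qExp d)))
      = corr (logKernel d k) (fun x => ENNReal.ofReal (logProfile d k f x)) t := by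
  rw [← lintegral_Ioi_exp_eq_corr] at h ⊢
  have hpos : ENNReal.ofReal (Real.exp (t * ((d - k) / qExp d))) ≠ 0 := by
    simpa using Real.exp_pos _
  have hfin := ENNReal.lt_top_of_mul_ne_top_right h hpos
  rw [T_eq_toReal_lintegral hf hf0 (Real.exp_pos t).le, abs_of_nonneg ENNReal.toReal_nonneg,
    ENNReal.ofReal_mul ENNReal.toReal_nonneg, ENNReal.ofReal_toReal hfin.ne, mul_comm]

end LogCoordinates

section Transfer

open scoped ENNReal

variable {d k : ℕ} {B : ℝ}

lemma pExp_pos (d k : ℕ) : 0 < pExp d k := by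
  unfold pExp
  positivity

lemma one_lt_pExp (hkd : k + 1 ≤ d) : 1 < pExp d k := by
  have : (k : ℝ) + 1 ≤ d := by exact_mod_cast hkd
  rw [pExp, one_lt_div (by positivity)]
  linarith

lemma pExp_lt_qExp (hk : 1 ≤ k) : pExp d k < qExp d := by
  have : (1 : ℝ) ≤ k := by exact_mod_cast hk
  exact div_lt_self (by positivity) (by linarith)

lemma qExp_pos (d : ℕ) : 0 < qExp d := by
  unfold qExp
  positivity

lemma one_div_pExp_add (hkd : k + 1 ≤ d) :
    1 / pExp d k + 1 / (((d : ℝ) + 1) / (d + 1 - k)) = 1 + 1 / qExp d := by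
  have : (k : ℝ) + 1 ≤ d := by exact_mod_cast hkd
  have h0 : (d : ℝ) + 1 - k ≠ 0 := by linarith
  unfold pExp qExp
  field_simp
  ring

lemma eLpNorm_mu_eq_lpSize_logProfile (hd : 1 ≤ d) (f : ℝ → ℝ) :
    eLpNorm f (ENNReal.ofReal (pExp d k)) (mu d)
      = lpSize (pExp d k) (fun t => ENNReal.ofReal |logProfile d k f t|) := by
  rw [eLpNorm_mu (pExp_pos d k) hd]
  simp only [logProfile, abs_mul, Real.abs_exp]

lemma eLpNorm_mu_eq_lpSize_logProfile_of_nonneg (hd : 1 ≤ d) {f : ℝ → ℝ} (hf0 : ∀ r, 0 ≤ f r) :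
    eLpNorm f (ENNReal.ofReal (pExp d k)) (mu d)
      = lpSize (pExp d k) (fun t => ENNReal.ofReal (logProfile d k f t)) := by
  rw [eLpNorm_mu_eq_lpSize_logProfile hd]
  simp only [abs_of_nonneg (logProfile_nonneg hf0 _)]

lemma eLpNorm_T_eq_lpSize_corr (hk : 1 ≤ k) (hkd : k + 1 ≤ d) {f : ℝ → ℝ} (hf : Measurable f)
    (hf0 : ∀ r, 0 ≤ f r)
    (hfin : lpSize (pExp d k) (fun t => ENNReal.ofReal (logProfile d k f t)) ≠ ∞) :
    eLpNorm (T k f) (ENNReal.ofReal (qExp d)) (nu d k)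
      = lpSize (qExp d) (corr (logKernel d k) fun t => ENNReal.ofReal (logProfile d k f t)) := by
  have hkd' : (k : ℝ) + 1 ≤ d := by exact_mod_cast hkd
  have hs : 0 < ((d : ℝ) + 1) / (d + 1 - k) := div_pos (by linarith) (by linarith)
  have hm : Measurable fun t => ENNReal.ofReal (logProfile d k f t) :=
    (measurable_logProfile hf).ennreal_ofReal
  have hle := lpSize_corr_le (one_lt_pExp hkd).le (pExp_lt_qExp hk).le hs (one_div_pExp_add hkd)
    (measurable_logKernel d k) hm
  have hK : lpSize (((d : ℝ) + 1) / (d + 1 - k)) (logKernel d k) ≠ ∞ :=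
    ENNReal.rpow_ne_top_of_nonneg (by positivity) (lintegral_logKernel_rpow_ne_top hk hkd)
  have hq : ∫⁻ t, corr (logKernel d k) (fun t => ENNReal.ofReal (logProfile d k f t)) t ^ qExp d
      ≠ ∞ := by
    rw [← lpSize_rpow (qExp_pos d)]
    exact ENNReal.rpow_ne_top_of_nonneg (qExp_pos d).le
      (ne_top_of_le_ne_top (ENNReal.mul_ne_top hK hfin) hle)
  have hae := ae_lt_top ((measurable_corr (measurable_logKernel d k) hm).pow_const _) hq
  rw [eLpNorm_nu (qExp_pos d) hkd, lpSize, lpSize]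
  congr 1
  refine lintegral_congr_ae ?_
  filter_upwards [hae] with t ht
  rw [ofReal_abs_T_mul_exp hf hf0]
  intro htop
  rw [htop, ENNReal.top_rpow_of_pos (qExp_pos d)] at ht
  exact lt_irrefl _ ht

lemma logProfile_log (F : ℝ → ℝ) :
    logProfile d k (fun r => F (Real.log r) * Real.exp (-(Real.log r * (d / pExp d k)))) = F := by
  ext t
  rw [logProfile, Real.log_exp, mul_assoc, ← Real.exp_add, neg_add_cancel, Real.exp_zero, mul_one]

lemma IsBestConstant.youngBound (hk : 1 ≤ k) (hkd : k + 1 ≤ d) (hBpos : 0 < B)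
    (hB : IsBestConstant d k B) :
    YoungBound (pExp d k) (qExp d) (((d : ℝ) + 1) / (d + 1 - k)) (logKernel d k)
      (ENNReal.ofReal B) where
  one_lt := one_lt_pExp hkd
  lt := pExp_lt_qExp hk
  pos := by
    have : (k : ℝ) + 1 ≤ d := by exact_mod_cast hkd
    exact div_pos (by linarith) (by linarith)
  exponents := one_div_pExp_add hkd
  measurable := measurable_logKernel d k
  lintegral_ne_top := lintegral_logKernel_rpow_ne_top hk hkd
  const_pos := by simpa using hBpos
  const_ne_top := ENNReal.ofReal_ne_top
  bound := by
    intro F hF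
    by_cases htop : lpSize (pExp d k) F = ∞
    · rw [htop, ENNReal.mul_top (by simpa using hBpos)]
      exact le_top
    set f : ℝ → ℝ := fun r =>
      (F (Real.log r)).toReal * Real.exp (-(Real.log r * (d / pExp d k))) with hf
    have hfm : Measurable f := by
      have : Measurable fun r => (F (Real.log r)).toReal :=
        (hF.comp Real.measurable_log).ennreal_toReal
      have : Measurable fun r => Real.exp (-(Real.log r * (d / pExp d k))) :=
        Real.measurable_exp.comp ((Real.measurable_log.mul_const _).neg)
      fun_prop
    have hf0 : ∀ r, 0 ≤ f r := fun r => mul_nonneg ENNReal.toReal_nonneg (Real.exp_pos _).le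
    have hprof : logProfile d k f = fun t => (F t).toReal := logProfile_log fun t => (F t).toReal
    have hae : (fun t => ENNReal.ofReal (logProfile d k f t)) =ᵐ[volume] F := by
      have hfin : ∫⁻ t, F t ^ pExp d k ≠ ∞ := by
        rw [← lpSize_rpow (pExp_pos d k)]
        exact ENNReal.rpow_ne_top_of_nonneg (pExp_pos d k).le htop
      filter_upwards [ae_lt_top (hF.pow_const _) hfin] with t ht
      rw [hprof, ENNReal.ofReal_toReal]
      intro h
      rw [h, ENNReal.top_rpow_of_pos (pExp_pos d k)] at ht
      exact lt_irrefl _ ht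
    have hsize : lpSize (pExp d k) (fun t => ENNReal.ofReal (logProfile d k f t))
        = lpSize (pExp d k) F := by
      rw [lpSize, lpSize]
      congr 1
      exact lintegral_congr_ae (hae.fun_comp (· ^ pExp d k))
    have hcorr : corr (logKernel d k) (fun t => ENNReal.ofReal (logProfile d k f t))
        = corr (logKernel d k) F := by
      ext t
      refine lintegral_congr_ae ?_
      filter_upwards [hae] with x hx
      rw [hx]
    have hmain := hB.1.2 f hfm hf0
    rwa [eLpNorm_T_eq_lpSize_corr hk hkd hfm hf0 (by rwa [hsize]),
      eLpNorm_mu_eq_lpSize_logProfile_of_nonneg (by omega) hf0, hsize, hcorr] at hmain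

lemma Extremizing.corrExtremizing {f : ℕ → ℝ → ℝ} (hk : 1 ≤ k) (hkd : k + 1 ≤ d)
    (hB : IsBestConstant d k B) (hf : Extremizing d k B f) :
    CorrExtremizing (pExp d k) (qExp d) (logKernel d k) (ENNReal.ofReal B)
      (fun n t => ENNReal.ofReal (logProfile d k (f n) t)) := by
  obtain ⟨hm, h0, h1, hlim⟩ := hf
  have hsize : ∀ n, lpSize (pExp d k) (fun t => ENNReal.ofReal (logProfile d k (f n) t)) = 1 :=
    fun n => by rw [← eLpNorm_mu_eq_lpSize_logProfile_of_nonneg (by omega) (h0 n), h1]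
  refine ⟨fun n => (measurable_logProfile (hm n)).ennreal_ofReal, fun n => ?_, ?_⟩
  · rw [← lpSize_rpow (pExp_pos d k), hsize, ENNReal.one_rpow]
  · have hfin : ∀ n, eLpNorm (T k (f n)) (ENNReal.ofReal (qExp d)) (nu d k) ≠ ∞ := fun n =>
      ne_top_of_le_ne_top (by rw [h1, mul_one]; exact ENNReal.ofReal_ne_top)
        (hB.1.2 _ (hm n) (h0 n))
    refine (ENNReal.tendsto_ofReal hlim).congr fun n => ?_
    rw [ENNReal.ofReal_toReal (hfin n),
      eLpNorm_T_eq_lpSize_corr hk hkd (hm n) (h0 n) (by simp [hsize])]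

lemma logProfile_dilate (f : ℝ → ℝ) (τ t : ℝ) :
    logProfile d k (fun r => Real.exp τ ^ ((d : ℝ) / pExp d k) * f (Real.exp τ * r)) t
      = logProfile d k f (t + τ) := by
  rw [logProfile, logProfile, ← Real.exp_mul, ← Real.exp_add, add_comm τ t, add_mul,
    Real.exp_add (t * _)]
  ring

/-- A sequence which is Cauchy for the `L^p` seminorm converges in `L^p`. -/
lemma exists_tendsto_eLpNorm_sub {α : Type*} [MeasurableSpace α] {μ : Measure α} {p : ℝ≥0∞}
    (hp : 1 ≤ p) {h : ℕ → α → ℝ} (hh : ∀ n, MemLp (h n) p μ)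
    (hc : Tendsto (fun z : ℕ × ℕ => eLpNorm (h z.1 - h z.2) p μ) (atTop ×ˢ atTop) (𝓝 0)) :
    ∃ g : α → ℝ, Tendsto (fun n => eLpNorm (h n - g) p μ) atTop (𝓝 0) := by
  have : Fact (1 ≤ p) := ⟨hp⟩
  have hcau : CauchySeq fun n => (hh n).toLp (h n) := by
    rw [Lp.cauchySeq_Lp_iff_cauchySeq_eLpNorm, ← prod_atTop_atTop_eq]
    refine hc.congr fun z => eLpNorm_congr_ae ?_
    exact (hh z.1).coeFn_toLp.symm.sub (hh z.2).coeFn_toLp.symm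
  obtain ⟨g, hg⟩ := cauchySeq_tendsto_of_complete hcau
  refine ⟨g, ?_⟩
  rw [Lp.tendsto_Lp_iff_tendsto_eLpNorm'] at hg
  exact hg.congr fun n => eLpNorm_congr_ae ((hh n).coeFn_toLp.sub EventuallyEq.rfl)

end Transfer

/-- extremizing sequences are relatively compact in `L^p(μ)` modulo dilations. -/
theorem extremizing_precompact_mod_dilations
    (d k : ℕ) (hd : 2 ≤ d) (hk1 : 1 ≤ k) (hkd : k ≤ d - 1)
    (B : ℝ) (hBpos : 0 < B) (hB : IsBestConstant d k B)
    (f : ℕ → ℝ → ℝ) (hf : Extremizing d k B f) :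
    ∃ σ : ℕ → ℕ, StrictMono σ ∧
      ∃ lam : ℕ → ℝ, (∀ n, 0 < lam n) ∧
        ∃ g : ℝ → ℝ,
          Tendsto
            (fun n => eLpNorm
              (fun r => (lam n) ^ ((d : ℝ) / pExp d k) * f (σ n) (lam n * r) - g r)
              (ENNReal.ofReal (pExp d k)) (mu d))
            atTop (𝓝 0) := by
  have hkd' : k + 1 ≤ d := by omega
  obtain ⟨hm, h0, h1, -⟩ := id hf
  have hY := hB.youngBound hk1 hkd' hBpos
  obtain ⟨σ, hσ, τ, hτ⟩ := (hf.corrExtremizing hk1 hkd' hB).exists_cauchy_translates hY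
    (fun n => measurable_logProfile (hm n)) (fun n => logProfile_nonneg (h0 n))
  set h : ℕ → ℝ → ℝ := fun n r =>
    Real.exp (τ n) ^ ((d : ℝ) / pExp d k) * f (σ n) (Real.exp (τ n) * r) with hh
  have hprof : ∀ n, logProfile d k (h n) = fun t => logProfile d k (f (σ n)) (t + τ n) :=
    fun n => funext fun t => logProfile_dilate _ _ _
  have hmeas : ∀ n, Measurable (h n) := fun n =>
    ((hm (σ n)).comp (measurable_const_mul _)).const_mul _
  have hpos : ∀ n r, 0 ≤ h n r := fun n r => mul_nonneg (by positivity) (h0 _ _)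
  have hmem : ∀ n, MemLp (h n) (ENNReal.ofReal (pExp d k)) (mu d) := by
    refine fun n => ⟨(hmeas n).aestronglyMeasurable, ?_⟩
    rw [eLpNorm_mu_eq_lpSize_logProfile_of_nonneg (by omega) (hpos n), hprof]
    have := lpSize_translate (pExp d k)
      (fun t => ENNReal.ofReal (logProfile d k (f (σ n)) t)) (τ n)
    rw [this, ← eLpNorm_mu_eq_lpSize_logProfile_of_nonneg (by omega) (h0 _), h1]
    exact ENNReal.one_lt_top
  refine ⟨σ, hσ, fun n => Real.exp (τ n), fun n => Real.exp_pos _, ?_⟩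
  refine exists_tendsto_eLpNorm_sub (h := h) (by simpa using (one_lt_pExp hkd').le) hmem ?_
  have hp0 : 0 < 1 / pExp d k := one_div_pos.2 (pExp_pos d k)
  have hlim := (ENNReal.continuous_rpow_const (y := 1 / pExp d k)).tendsto 0 |>.comp hτ
  rw [ENNReal.zero_rpow_of_pos hp0] at hlim
  refine hlim.congr fun z => ?_
  rw [eLpNorm_mu_eq_lpSize_logProfile (by omega), lpSize, Function.comp_apply]
  congr 2
  ext t
  have e : logProfile d k (h z.1 - h z.2) t
      = logProfile d k (h z.1) t - logProfile d k (h z.2) t := by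
    simp only [logProfile, Pi.sub_apply, sub_mul]
  rw [e, hprof, hprof]
end
end

section
/- There exists a finite constant C = C(k,d) such that for every nonnegative measurable function f on (0,∞) one has ‖T f‖_{L^q(ν)} ≤ C ‖f‖_{L^p(μ)}; that is, T extends to a bounded linear operator from L^p(μ) to L^q(ν). -/
open MeasureTheory Set Filter Topology

noncomputable section

open scoped ENNReal

/-- Young's convolution inequality on the line, for the powers `A ^ a` and `B ^ b` of
nonnegative functions, with `a + b = 1 + 1 / q`. -/
theorem lintegral_rpow_correlation_le {A B : ℝ → ℝ≥0∞} (hA : Measurable A) (hB : Measurable B)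
    {a b q : ℝ} (hq : 0 < q) (ha : 1 / q ≤ a) (hb : 1 / q ≤ b) (hab : a + b = 1 + 1 / q) :
    ∫⁻ x, (∫⁻ t, A (x + t) ^ a * B t ^ b) ^ q ≤ (∫⁻ y, A y) ^ (q * a) * (∫⁻ t, B t) ^ (q * b) := by
  have hq' : 0 < 1 / q := by positivity
  set IA := ∫⁻ y, A y
  set IB := ∫⁻ t, B t
  have holder (x : ℝ) : ∫⁻ t, A (x + t) ^ a * B t ^ b ≤
      (∫⁻ t, A (x + t) * B t) ^ (1 / q) * IA ^ (a - 1 / q) * IB ^ (b - 1 / q) := by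
    have hAx : Measurable fun t => A (x + t) := by fun_prop
    have h := ENNReal.lintegral_prod_norm_pow_le (μ := volume) (Finset.univ : Finset (Fin 3))
      (f := ![fun t => A (x + t) * B t, fun t => A (x + t), B])
      (p := ![1 / q, a - 1 / q, b - 1 / q])
      (by
        intro i _
        fin_cases i
        · exact (hAx.mul hB).aemeasurable
        · exact hAx.aemeasurable
        · exact hB.aemeasurable)
      (by simp [Fin.sum_univ_three]; simp at hab; linarith)
      (by
        intro i _
        fin_cases i
        · exact hq'.le
        · exact sub_nonneg.2 ha
        · exact sub_nonneg.2 hb)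
    simp only [Fin.prod_univ_three, Matrix.cons_val_zero, Matrix.cons_val_one,
      Matrix.cons_val] at h
    rw [lintegral_add_left_eq_self (μ := volume) A x] at h
    refine le_trans (le_of_eq (lintegral_congr fun t => ?_)) h
    rw [ENNReal.mul_rpow_of_nonneg _ _ hq'.le]
    calc A (x + t) ^ a * B t ^ b
        = A (x + t) ^ (1 / q + (a - 1 / q)) * B t ^ (1 / q + (b - 1 / q)) := by
          congr 2 <;> ring
      _ = _ := by
          rw [ENNReal.rpow_add_of_nonneg _ _ hq'.le (sub_nonneg.2 ha),
            ENNReal.rpow_add_of_nonneg _ _ hq'.le (sub_nonneg.2 hb)]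
          ring
  have tonelli : ∫⁻ x, ∫⁻ t, A (x + t) * B t = IA * IB := by
    rw [lintegral_lintegral_swap (by fun_prop)]
    have (t : ℝ) : ∫⁻ x, A (x + t) * B t = IA * B t := by
      rw [lintegral_mul_const _ (by fun_prop), lintegral_add_right_eq_self (μ := volume) A t]
    simp_rw [this]
    rw [lintegral_const_mul _ hB]
  calc ∫⁻ x, (∫⁻ t, A (x + t) ^ a * B t ^ b) ^ q
      ≤ ∫⁻ x, (∫⁻ t, A (x + t) * B t) * (IA ^ (q * a - 1) * IB ^ (q * b - 1)) := by
        refine lintegral_mono fun x => (ENNReal.rpow_le_rpow (holder x) hq.le).trans_eq ?_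
        rw [ENNReal.mul_rpow_of_nonneg _ _ hq.le, ENNReal.mul_rpow_of_nonneg _ _ hq.le,
          ← ENNReal.rpow_mul, ← ENNReal.rpow_mul, ← ENNReal.rpow_mul,
          one_div_mul_cancel hq.ne', ENNReal.rpow_one, mul_assoc]
        congr 3 <;> field_simp
    _ = IA * IB * (IA ^ (q * a - 1) * IB ^ (q * b - 1)) := by
        rw [lintegral_mul_const, tonelli]
        exact Measurable.lintegral_prod_right' (f := fun z : ℝ × ℝ => A (z.1 + z.2) * B z.2)
          (by fun_prop)
    _ = IA ^ (q * a) * IB ^ (q * b) := by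
        have h1 : 0 ≤ q * a - 1 := by
          have := mul_le_mul_of_nonneg_left ha hq.le
          rw [mul_one_div_cancel hq.ne'] at this
          linarith
        have h2 : 0 ≤ q * b - 1 := by
          have := mul_le_mul_of_nonneg_left hb hq.le
          rw [mul_one_div_cancel hq.ne'] at this
          linarith
        rw [show q * a = 1 + (q * a - 1) by ring, show q * b = 1 + (q * b - 1) by ring,
          ENNReal.rpow_add_of_nonneg _ _ zero_le_one h1,
          ENNReal.rpow_add_of_nonneg _ _ zero_le_one h2]
        simp only [ENNReal.rpow_one, add_sub_cancel_left]
        ring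

/-- The substitution `r = exp x` for the measure `r ^ n dr` on the half line. -/
theorem lintegral_withDensity_pow_eq (n : ℕ) (g : ℝ → ℝ≥0∞) :
    ∫⁻ r, g r ∂((volume.restrict (Ioi (0 : ℝ))).withDensity fun r => ENNReal.ofReal (r ^ n)) =
      ∫⁻ x, ENNReal.ofReal (Real.exp ((n + 1) * x)) * g (Real.exp x) := by
  rw [lintegral_withDensity_eq_lintegral_mul_non_measurable _ (by fun_prop)
    (Eventually.of_forall fun _ => ENNReal.ofReal_lt_top), ← Real.range_exp, ← image_univ,
    lintegral_image_eq_lintegral_abs_deriv_mul MeasurableSet.univ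
      (fun x _ => (Real.hasDerivAt_exp x).hasDerivWithinAt) Real.exp_injective.injOn,
    Measure.restrict_univ]
  refine lintegral_congr fun x => ?_
  rw [Pi.mul_apply, ← mul_assoc, abs_of_pos (Real.exp_pos x),
    ← ENNReal.ofReal_mul (Real.exp_pos x).le, ← Real.exp_nat_mul, ← Real.exp_add]
  ring_nf

/-- The substitution `u = exp (x + t)` on `(exp x, ∞)`. -/
theorem setLIntegral_Ioi_exp_eq (x : ℝ) (g : ℝ → ℝ≥0∞) :
    ∫⁻ u in Ioi (Real.exp x), g u =
      ∫⁻ t in Ioi 0, ENNReal.ofReal (Real.exp (x + t)) * g (Real.exp (x + t)) := by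
  have himage : (fun t => Real.exp (x + t)) '' Ioi 0 = Ioi (Real.exp x) := by
    ext u
    simp only [mem_image, mem_Ioi]
    constructor
    · rintro ⟨t, ht, rfl⟩
      exact Real.exp_lt_exp.2 (by linarith)
    · intro hu
      have hu0 : 0 < u := (Real.exp_pos x).trans hu
      refine ⟨Real.log u - x, sub_pos.2 ((Real.lt_log_iff_exp_lt hu0).2 hu), ?_⟩
      rw [add_sub_cancel, Real.exp_log hu0]
  rw [← himage, lintegral_image_eq_lintegral_abs_deriv_mul (f' := fun t => Real.exp (x + t))
    measurableSet_Ioi]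
  · simp_rw [abs_of_pos (Real.exp_pos _)]
  · intro t _
    simpa using (((hasDerivAt_id t).const_add x).exp).hasDerivWithinAt
  · intro s _ t _ h
    simpa using h

theorem lintegral_exp_neg_mul_one_sub_exp_rpow_lt_top {c s : ℝ} (hc : 0 < c) (hs : -1 < s) :
    ∫⁻ t in Ioi (0 : ℝ),
      ENNReal.ofReal (Real.exp (-c * t) * (1 - Real.exp (-2 * t)) ^ s) < ∞ := by
  set σ := min s 0
  have hσ1 : -1 < σ := lt_min hs (by norm_num)
  have hσ0 : σ ≤ 0 := min_le_right _ _
  have hint : IntegrableOn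
      (fun t : ℝ => t ^ (0 : ℝ) * Real.exp (-c * t ^ (1 : ℝ)) +
        t ^ σ * Real.exp (-c * t ^ (1 : ℝ))) (Ioi 0) :=
    (integrableOn_rpow_mul_exp_neg_mul_rpow (by norm_num) one_pos hc).add
      (integrableOn_rpow_mul_exp_neg_mul_rpow hσ1 one_pos hc)
  refine lt_of_le_of_lt (setLIntegral_mono' measurableSet_Ioi fun t ht => ?_) hint.lintegral_lt_top
  have ht : 0 < t := ht
  refine ENNReal.ofReal_le_ofReal ?_
  rw [Real.rpow_zero, Real.rpow_one, one_mul, ← one_add_mul, mul_comm]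
  refine mul_le_mul_of_nonneg_right ?_ (Real.exp_pos _).le
  have hexp : Real.exp (-2 * t) * (1 + 2 * t) ≤ 1 := by
    calc Real.exp (-2 * t) * (1 + 2 * t) ≤ Real.exp (-2 * t) * Real.exp (2 * t) := by
          gcongr
          linarith [Real.add_one_le_exp (2 * t)]
      _ = 1 := by rw [← Real.exp_add]; simp
  have hlower : 2 * t / (1 + 2 * t) ≤ 1 - Real.exp (-2 * t) := by
    rw [div_le_iff₀ (by positivity)]
    linarith
  have hpos : 0 < 1 - Real.exp (-2 * t) := lt_of_lt_of_le (by positivity) hlower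
  calc (1 - Real.exp (-2 * t)) ^ s
      ≤ (1 - Real.exp (-2 * t)) ^ σ :=
        Real.rpow_le_rpow_of_exponent_ge hpos (by linarith [Real.exp_pos (-2 * t)])
          (min_le_left _ _)
    _ ≤ (2 * t / (1 + 2 * t)) ^ σ := Real.rpow_le_rpow_of_nonpos (by positivity) hlower hσ0
    _ = (1 + (2 * t)⁻¹) ^ (-σ) := by
        rw [Real.rpow_neg (by positivity), ← Real.inv_rpow (by positivity)]
        congr 1
        field_simp
        ring
    _ ≤ 1 ^ (-σ) + ((2 * t)⁻¹) ^ (-σ) :=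
        Real.rpow_add_le_add_rpow zero_le_one (by positivity) (by linarith) (by linarith)
    _ ≤ 1 + t ^ σ := by
        rw [Real.one_rpow, Real.inv_rpow (by positivity), Real.rpow_neg (by positivity), inv_inv]
        gcongr 1 + ?_
        exact Real.rpow_le_rpow_of_nonpos ht (by linarith) hσ0

/-- In logarithmic coordinates `T` is dominated by a convolution operator. -/
theorem enorm_T_exp_mul_le {d k : ℕ} (hkd : k < d) {f : ℝ → ℝ} (hf : ∀ r, 0 ≤ f r) (x : ℝ) :
    ENNReal.ofReal (Real.exp (((d : ℝ) - k) / (d + 1) * x)) * ‖T k f (Real.exp x)‖ₑ ≤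
      ∫⁻ t, ENNReal.ofReal (f (Real.exp (x + t)) ^ pExp d k * Real.exp (d * (x + t))) ^
          (((k : ℝ) + 1) / (d + 1)) *
        (Ioi (0 : ℝ)).indicator (fun t => ENNReal.ofReal
          (Real.exp (-(((d : ℝ) - k) / (d + 1 - k)) * t) * (1 - Real.exp (-2 * t)) ^
            (((d : ℝ) + 1) / (d + 1 - k) * ((k : ℝ) / 2 - 1)))) t ^
          (((d : ℝ) + 1 - k) / (d + 1)) := by
  have hkd' : (k : ℝ) < d := by exact_mod_cast hkd
  have hdk : (0 : ℝ) < d + 1 - k := by linarith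
  refine le_trans ?_ (setLIntegral_le_lintegral (Ioi 0) _)
  refine (mul_le_mul_right (enorm_integral_le_lintegral_enorm _) _).trans ?_
  rw [setLIntegral_Ioi_exp_eq, ← lintegral_const_mul' _ _ ENNReal.ofReal_ne_top]
  refine (setLIntegral_congr_fun measurableSet_Ioi fun t ht => ?_).le
  have ht0 : 0 < t := ht
  have hone : 0 < 1 - Real.exp (-2 * t) := by
    rw [sub_pos, Real.exp_lt_one_iff]
    linarith
  have hfac : Real.exp (x + t) ^ 2 - Real.exp x ^ 2 =
      Real.exp (2 * (x + t)) * (1 - Real.exp (-2 * t)) := by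
    rw [mul_sub, ← Real.exp_add, ← Real.exp_nat_mul, ← Real.exp_nat_mul]
    push_cast
    ring_nf
  have hfx := hf (Real.exp (x + t))
  simp only [indicator_of_mem ht]
  rw [hfac, Real.enorm_of_nonneg (by positivity), ENNReal.ofReal_rpow_of_nonneg (by positivity)
    (by positivity), ENNReal.ofReal_rpow_of_nonneg (by positivity) (by positivity),
    ← ENNReal.ofReal_mul (by positivity), ← ENNReal.ofReal_mul (by positivity),
    ← ENNReal.ofReal_mul (by positivity)]
  congr 1
  rw [Real.mul_rpow (by positivity) hone.le, Real.mul_rpow (by positivity) (by positivity),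
    Real.mul_rpow (by positivity) (by positivity), ← Real.rpow_mul hfx, ← Real.rpow_mul hone.le,
    ← Real.exp_mul, ← Real.exp_mul, ← Real.exp_mul, pExp,
    show ((d : ℝ) + 1) / (k + 1) * ((k + 1) / (d + 1)) = 1 by field_simp, Real.rpow_one,
    show ((d : ℝ) + 1) / (d + 1 - k) * ((k : ℝ) / 2 - 1) * ((d + 1 - k) / (d + 1)) =
      (k : ℝ) / 2 - 1 by field_simp]
  have hexp : Real.exp (((d : ℝ) - k) / (d + 1) * x) * Real.exp (x + t) *
      Real.exp (2 * (x + t) * ((k : ℝ) / 2 - 1)) * Real.exp (x + t) =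
      Real.exp (d * (x + t) * ((k + 1) / (d + 1))) *
        Real.exp (-(((d : ℝ) - k) / (d + 1 - k)) * t * ((d + 1 - k) / (d + 1))) := by
    simp only [← Real.exp_add]
    congr 1
    field_simp
    ring
  linear_combination f (Real.exp (x + t)) * (1 - Real.exp (-2 * t)) ^ ((k : ℝ) / 2 - 1) * hexp

/-- `T` is bounded from `L^p(μ)` to `L^q(ν)`. -/
theorem T_bounded
    (d k : ℕ) (hd : 2 ≤ d) (hk1 : 1 ≤ k) (hkd : k ≤ d - 1) :
    ∃ C : ℝ, 0 ≤ C ∧ ∀ f : ℝ → ℝ, Measurable f → (∀ r, 0 ≤ f r) →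
      eLpNorm (T k f) (ENNReal.ofReal (qExp d)) (nu d k) ≤
        ENNReal.ofReal C * eLpNorm f (ENNReal.ofReal (pExp d k)) (mu d) := by
  have hkd' : k + 1 ≤ d := by omega
  have hkdR : (k : ℝ) + 1 ≤ d := by exact_mod_cast hkd'
  have hk1R : (1 : ℝ) ≤ k := by exact_mod_cast hk1
  have hdR : (2 : ℝ) ≤ d := by exact_mod_cast hd
  have hdk : (0 : ℝ) < d + 1 - k := by linarith
  have hq : 0 < qExp d := by unfold qExp; positivity
  have hp : 0 < pExp d k := by unfold pExp; positivity
  set B : ℝ → ℝ≥0∞ := (Ioi (0 : ℝ)).indicator (fun t => ENNReal.ofReal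
    (Real.exp (-(((d : ℝ) - k) / (d + 1 - k)) * t) * (1 - Real.exp (-2 * t)) ^
      (((d : ℝ) + 1) / (d + 1 - k) * ((k : ℝ) / 2 - 1)))) with hBdef
  have hB : Measurable B := Measurable.indicator (by fun_prop) measurableSet_Ioi
  set b : ℝ := ((d : ℝ) + 1 - k) / (d + 1) with hb
  have hb0 : 0 ≤ b := by positivity
  have hBtop : ∫⁻ t, B t < ∞ := by
    rw [hBdef, lintegral_indicator measurableSet_Ioi]
    refine lintegral_exp_neg_mul_one_sub_exp_rpow_lt_top (div_pos (by linarith) hdk) ?_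
    rw [div_mul_eq_mul_div, lt_div_iff₀ hdk]
    nlinarith
  have hCtop : (∫⁻ t, B t) ^ b ≠ ∞ := ENNReal.rpow_ne_top_of_nonneg hb0 hBtop.ne
  refine ⟨((∫⁻ t, B t) ^ b).toReal, ENNReal.toReal_nonneg, fun f hfm hf => ?_⟩
  rw [ENNReal.ofReal_toReal hCtop,
    eLpNorm_eq_lintegral_rpow_enorm_toReal (by simpa using hq) ENNReal.ofReal_ne_top,
    eLpNorm_eq_lintegral_rpow_enorm_toReal (by simpa using hp) ENNReal.ofReal_ne_top,
    ENNReal.toReal_ofReal hq.le, ENNReal.toReal_ofReal hp.le, nu, mu,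
    lintegral_withDensity_pow_eq, lintegral_withDensity_pow_eq]
  set A : ℝ → ℝ≥0∞ := fun y =>
    ENNReal.ofReal (f (Real.exp y) ^ pExp d k * Real.exp (d * y))
  have hA : Measurable A := by fun_prop
  have hAint : ∫⁻ x, ENNReal.ofReal (Real.exp ((((d - 1 : ℕ) : ℝ) + 1) * x)) *
      ‖f (Real.exp x)‖ₑ ^ pExp d k = ∫⁻ y, A y := by
    refine lintegral_congr fun x => ?_
    have hcast : ((d - 1 : ℕ) : ℝ) + 1 = d := by
      rw [Nat.cast_sub (by omega)]
      simp
    rw [hcast, Real.enorm_of_nonneg (hf _), ENNReal.ofReal_rpow_of_nonneg (hf _) hp.le,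
      ← ENNReal.ofReal_mul (Real.exp_pos _).le, mul_comm]
  have hTint : ∫⁻ x, ENNReal.ofReal (Real.exp ((((d - k - 1 : ℕ) : ℝ) + 1) * x)) *
      ‖T k f (Real.exp x)‖ₑ ^ qExp d ≤
      ∫⁻ x, (∫⁻ t, A (x + t) ^ (((k : ℝ) + 1) / (d + 1)) * B t ^ b) ^ qExp d := by
    refine lintegral_mono fun x => ?_
    refine le_trans (le_of_eq ?_) (ENNReal.rpow_le_rpow (enorm_T_exp_mul_le hkd' hf x) hq.le)
    have hcast : ((d - k - 1 : ℕ) : ℝ) + 1 = d - k := by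
      rw [Nat.sub_sub, Nat.cast_sub hkd']
      push_cast
      ring
    rw [hcast, ENNReal.mul_rpow_of_nonneg _ _ hq.le,
      ENNReal.ofReal_rpow_of_nonneg (Real.exp_pos _).le hq.le, ← Real.exp_mul]
    congr 3
    unfold qExp
    field_simp
  rw [hAint]
  have hyoung := lintegral_rpow_correlation_le hA hB (a := ((k : ℝ) + 1) / (d + 1)) (b := b) hq
    (by unfold qExp; gcongr; linarith) (by rw [hb]; unfold qExp; gcongr; linarith)
    (by rw [hb]; unfold qExp; field_simp; ring)
  refine (ENNReal.rpow_le_rpow (hTint.trans hyoung) (by positivity)).trans_eq ?_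
  rw [ENNReal.mul_rpow_of_nonneg _ _ (by positivity), ← ENNReal.rpow_mul, ← ENNReal.rpow_mul,
    mul_comm]
  congr 2
  · field_simp
  · unfold pExp qExp
    field_simp
end
end

section
/- Let k ≥ 2, let R > 0, and let F ⊆ [R, ∞) be a measurable set with μ(F) = δ (so F is disjoint from [0,R]). Then ‖T 1_F‖_{L^q(ν)} ≤ 2 δ R^{d(k−d)/(d+1)}. Moreover one has the pointwise bound T 1_F(r) ≤ max(r,R)^{k−d} δ for every r > 0. -/
open MeasureTheory Set Filter Topology

noncomputable section

/-- For `F ⊆ (0, ∞)` the measure `mu d F` is the integral of `u ^ (d - 1)` over `F`. -/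
theorem integrableOn_pow_and_setIntegral_of_mu_eq {d : ℕ} {F : Set ℝ} (hF : MeasurableSet F)
    (hF0 : F ⊆ Ioi 0) {δ : ℝ} (hδ : 0 ≤ δ) (h : mu d F = ENNReal.ofReal δ) :
    IntegrableOn (fun u : ℝ => u ^ (d - 1)) F ∧ ∫ u in F, u ^ (d - 1) = δ := by
  rw [mu, withDensity_apply _ hF, Measure.restrict_restrict hF, inter_eq_left.2 hF0] at h
  have hnn : 0 ≤ᵐ[volume.restrict F] fun u : ℝ => u ^ (d - 1) := by
    filter_upwards [ae_restrict_mem hF] with u hu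
    exact pow_nonneg (le_of_lt (hF0 hu)) _
  have hmeas : AEStronglyMeasurable (fun u : ℝ => u ^ (d - 1)) (volume.restrict F) := by
    fun_prop
  refine ⟨⟨hmeas, ?_⟩, ?_⟩
  · rw [hasFiniteIntegral_iff_ofReal hnn, h]
    exact ENNReal.ofReal_lt_top
  · rw [integral_eq_lintegral_of_nonneg_ae hnn hmeas, h, ENNReal.toReal_ofReal hδ]

theorem T_indicator_nonneg (k : ℕ) (F : Set ℝ) {r : ℝ} (hr : 0 < r) :
    0 ≤ T k (F.indicator (fun _ => (1 : ℝ))) r := by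
  refine setIntegral_nonneg measurableSet_Ioi fun u hu => ?_
  have hu : r < u := hu
  have : 0 ≤ u ^ 2 - r ^ 2 := by nlinarith
  have h1 : 0 ≤ F.indicator (fun _ => (1 : ℝ)) u := indicator_nonneg (fun _ _ => zero_le_one) u
  have h2 : 0 ≤ u := by linarith
  positivity

/-- The kernel of `T` against the density of `mu`. -/
theorem kernel_le_max_rpow_mul_pow {d k : ℕ} (hk : 2 ≤ k) (hkd : k < d) {R r u : ℝ}
    (hr : 0 < r) (hru : r < u) (hRu : R ≤ u) :
    (u ^ 2 - r ^ 2) ^ ((k : ℝ) / 2 - 1) * u ≤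
      (max r R) ^ ((k : ℝ) - (d : ℝ)) * u ^ (d - 1) := by
  have hu : 0 < u := hr.trans hru
  have hk' : (2 : ℝ) ≤ k := by exact_mod_cast hk
  have hkd' : (k : ℝ) ≤ d := by exact_mod_cast hkd.le
  have hm : 0 < max r R := lt_max_of_lt_left hr
  calc (u ^ 2 - r ^ 2) ^ ((k : ℝ) / 2 - 1) * u
      ≤ (u ^ 2) ^ ((k : ℝ) / 2 - 1) * u := by
        refine mul_le_mul_of_nonneg_right (Real.rpow_le_rpow ?_ ?_ ?_) hu.le
        · nlinarith
        · nlinarith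
        · linarith
    _ = u ^ ((k : ℝ) - d) * u ^ (d - 1) := by
        rw [← Real.rpow_natCast u 2, ← Real.rpow_mul hu.le, ← Real.rpow_add_one hu.ne',
          ← Real.rpow_natCast u (d - 1), ← Real.rpow_add hu, Nat.cast_sub (by omega)]
        congr 1
        push_cast
        ring
    _ ≤ (max r R) ^ ((k : ℝ) - d) * u ^ (d - 1) := by
        refine mul_le_mul_of_nonneg_right ?_ (by positivity)
        exact Real.rpow_le_rpow_of_nonpos hm (max_le hru.le hRu) (by linarith)

theorem T_indicator_le {d k : ℕ} (hk : 2 ≤ k) (hkd : k < d) {R : ℝ} (hR : 0 < R)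
    {F : Set ℝ} (hF : MeasurableSet F) (hFsub : F ⊆ Ici R) {δ : ℝ} (hδ : 0 ≤ δ)
    (hFmu : mu d F = ENNReal.ofReal δ) {r : ℝ} (hr : 0 < r) :
    T k (F.indicator (fun _ => (1 : ℝ))) r ≤ (max r R) ^ ((k : ℝ) - (d : ℝ)) * δ := by
  have hF0 : F ⊆ Ioi 0 := fun u hu => hR.trans_le (hFsub hu)
  obtain ⟨hint, heq⟩ := integrableOn_pow_and_setIntegral_of_mu_eq hF hF0 hδ hFmu
  have hT : T k (F.indicator (fun _ => (1 : ℝ))) r =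
      ∫ u in Ioi r ∩ F, (u ^ 2 - r ^ 2) ^ ((k : ℝ) / 2 - 1) * u := by
    rw [T, ← setIntegral_indicator hF]
    congr 1 with u
    by_cases hu : u ∈ F <;> simp [hu]
  have hS : MeasurableSet (Ioi r ∩ F) := measurableSet_Ioi.inter hF
  rw [hT, ← heq, ← integral_const_mul]
  calc ∫ u in Ioi r ∩ F, (u ^ 2 - r ^ 2) ^ ((k : ℝ) / 2 - 1) * u
      ≤ ∫ u in Ioi r ∩ F, (max r R) ^ ((k : ℝ) - (d : ℝ)) * u ^ (d - 1) := by
        refine integral_mono_of_nonneg ?_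
          ((hint.mono_set inter_subset_right).const_mul _) ?_
        · filter_upwards [ae_restrict_mem hS] with u hu
          have hru : r < u := hu.1
          exact mul_nonneg (Real.rpow_nonneg (by nlinarith) _) (by linarith)
        · filter_upwards [ae_restrict_mem hS] with u hu
          exact kernel_le_max_rpow_mul_pow hk hkd hr hu.1 (hFsub hu.2)
    _ ≤ ∫ u in F, (max r R) ^ ((k : ℝ) - (d : ℝ)) * u ^ (d - 1) := by
        refine setIntegral_mono_set (hint.const_mul _) ?_ inter_subset_right.eventuallyLE
        filter_upwards [ae_restrict_mem hF] with u hu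
        have hu0 : 0 < u := hF0 hu
        have : 0 < max r R := lt_max_of_lt_left hr
        positivity

theorem lintegral_max_rpow_nu_le {d k : ℕ} (hkd : k < d) {R : ℝ} (hR : 0 < R) :
    ∫⁻ r, ENNReal.ofReal ((max r R) ^ (((k : ℝ) - d) * (d + 1))) ∂(nu d k) ≤
      ENNReal.ofReal (2 * R ^ ((d : ℝ) * ((k : ℝ) - d))) := by
  obtain ⟨n, rfl⟩ : ∃ n, d = k + n + 1 := ⟨d - k - 1, by omega⟩
  set D : ℝ := ((k + n + 1 : ℕ) : ℝ) with hD
  have hD' : D = k + n + 1 := by rw [hD]; push_cast; ring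
  have hD1 : 1 ≤ D := by rw [hD']; linarith [k.cast_nonneg (α := ℝ), n.cast_nonneg (α := ℝ)]
  have hn : (0 : ℝ) ≤ n := n.cast_nonneg
  have ha : (k : ℝ) - D = -(n + 1) := by rw [hD']; ring
  have hexp : D * ((k : ℝ) - D) - 1 < -1 := by rw [ha]; nlinarith
  rw [nu, show k + n + 1 - k - 1 = n by omega,
    lintegral_withDensity_eq_lintegral_mul _ (by fun_prop) (by fun_prop),
    ← Ioc_union_Ioi_eq_Ioi hR.le,
    lintegral_union measurableSet_Ioi (Ioc_disjoint_Ioi le_rfl)]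
  have hnear : ∫⁻ r in Ioc 0 R, ((fun r : ℝ => ENNReal.ofReal (r ^ n)) *
      fun r => ENNReal.ofReal ((max r R) ^ (((k : ℝ) - D) * (D + 1)))) r =
      ENNReal.ofReal (R ^ (D * ((k : ℝ) - D)) / (n + 1)) := by
    have hcongr : ∫⁻ r in Ioc 0 R, ((fun r : ℝ => ENNReal.ofReal (r ^ n)) *
        fun r => ENNReal.ofReal ((max r R) ^ (((k : ℝ) - D) * (D + 1)))) r =
        ∫⁻ r in Ioc 0 R, ENNReal.ofReal (r ^ n * R ^ (((k : ℝ) - D) * (D + 1))) := by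
      refine setLIntegral_congr_fun measurableSet_Ioc fun r hr => ?_
      simp only [Pi.mul_apply]
      rw [max_eq_right hr.2, ENNReal.ofReal_mul (pow_nonneg hr.1.le _)]
    rw [hcongr, ← ofReal_integral_eq_lintegral_ofReal]
    · congr 1
      rw [← intervalIntegral.integral_of_le hR.le, intervalIntegral.integral_mul_const,
        integral_pow, zero_pow (Nat.succ_ne_zero n), sub_zero, div_mul_eq_mul_div,
        ← Real.rpow_natCast, ← Real.rpow_add hR]
      congr 2
      push_cast
      rw [ha]
      ring
    · exact (Continuous.integrableOn_Ioc (by fun_prop))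
    · filter_upwards [ae_restrict_mem measurableSet_Ioc] with r hr
      have := hr.1
      positivity
  have hfar : ∫⁻ r in Ioi R, ((fun r : ℝ => ENNReal.ofReal (r ^ n)) *
      fun r => ENNReal.ofReal ((max r R) ^ (((k : ℝ) - D) * (D + 1)))) r =
      ENNReal.ofReal (R ^ (D * ((k : ℝ) - D)) / (D * (n + 1))) := by
    have hcongr : ∫⁻ r in Ioi R, ((fun r : ℝ => ENNReal.ofReal (r ^ n)) *
        fun r => ENNReal.ofReal ((max r R) ^ (((k : ℝ) - D) * (D + 1)))) r =
        ∫⁻ r in Ioi R, ENNReal.ofReal (r ^ (D * ((k : ℝ) - D) - 1)) := by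
      refine setLIntegral_congr_fun measurableSet_Ioi fun r hr => ?_
      have hRr : R < r := hr
      have hr0 : 0 < r := hR.trans hRr
      simp only [Pi.mul_apply]
      rw [max_eq_left hRr.le, ← ENNReal.ofReal_mul (pow_nonneg hr0.le _),
        ← Real.rpow_natCast, ← Real.rpow_add hr0]
      congr 2
      rw [ha]
      ring
    rw [hcongr, ← ofReal_integral_eq_lintegral_ofReal (integrableOn_Ioi_rpow_of_lt hexp hR)]
    · rw [integral_Ioi_rpow_of_lt hexp hR, sub_add_cancel, ha, mul_neg, neg_div_neg_eq]
    · filter_upwards [ae_restrict_mem measurableSet_Ioi] with r hr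
      exact Real.rpow_nonneg (hR.trans hr).le _
  rw [hnear, hfar, ← ENNReal.ofReal_add (by positivity) (by positivity)]
  refine ENNReal.ofReal_le_ofReal ?_
  have hpos : 0 ≤ R ^ (D * ((k : ℝ) - D)) := by positivity
  have h1 := div_le_self hpos (show (1 : ℝ) ≤ n + 1 by linarith)
  have h2 := div_le_self hpos (show (1 : ℝ) ≤ D * (n + 1) by nlinarith)
  linarith

theorem eLpNorm_max_rpow_le {d k : ℕ} (hkd : k < d) {R : ℝ} (hR : 0 < R) :
    eLpNorm (fun r => (max r R) ^ ((k : ℝ) - (d : ℝ))) (ENNReal.ofReal (qExp d)) (nu d k) ≤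
      ENNReal.ofReal (2 * R ^ ((d : ℝ) * ((k : ℝ) - (d : ℝ)) / ((d : ℝ) + 1))) := by
  have hq : (0 : ℝ) < (d : ℝ) + 1 := by positivity
  have hq1 : 1 / ((d : ℝ) + 1) ≤ 1 := by
    rw [div_le_one hq]
    linarith [d.cast_nonneg (α := ℝ)]
  rw [eLpNorm_eq_lintegral_rpow_enorm_toReal (by simpa [qExp] using hq) ENNReal.ofReal_ne_top,
    qExp, ENNReal.toReal_ofReal hq.le]
  have hint : ∀ r : ℝ, ‖(max r R) ^ ((k : ℝ) - (d : ℝ))‖ₑ ^ ((d : ℝ) + 1) =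
      ENNReal.ofReal ((max r R) ^ (((k : ℝ) - d) * (d + 1))) := fun r => by
    have hm : 0 < max r R := lt_max_of_lt_right hR
    rw [Real.enorm_of_nonneg (by positivity), ENNReal.ofReal_rpow_of_nonneg (by positivity) hq.le,
      ← Real.rpow_mul hm.le]
  simp only [hint]
  calc _ ≤ ENNReal.ofReal (2 * R ^ ((d : ℝ) * ((k : ℝ) - d))) ^ (1 / ((d : ℝ) + 1)) :=
        ENNReal.rpow_le_rpow (lintegral_max_rpow_nu_le hkd hR) (by positivity)
    _ ≤ _ := by
        rw [ENNReal.ofReal_rpow_of_nonneg (by positivity) (by positivity),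
          Real.mul_rpow (by norm_num) (by positivity), ← Real.rpow_mul hR.le, mul_one_div]
        refine ENNReal.ofReal_le_ofReal (mul_le_mul_of_nonneg_right ?_ (by positivity))
        simpa using Real.rpow_le_rpow_of_exponent_le (x := 2) (by norm_num) hq1

/-- bound on `T 1_F` for sets `F` far from the origin, case `k ≥ 2`. -/
theorem T_indicator_far_set_bound_k_ge_two
    (d k : ℕ) (hd : 3 ≤ d) (hk : 2 ≤ k) (hkd : k ≤ d - 1)
    (R : ℝ) (hR : 0 < R) (F : Set ℝ) (hFmeas : MeasurableSet F) (hFsub : F ⊆ Ici R)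
    (δ : ℝ) (hδ : 0 ≤ δ) (hFmu : mu d F = ENNReal.ofReal δ) :
    eLpNorm (T k (F.indicator (fun _ => (1 : ℝ)))) (ENNReal.ofReal (qExp d)) (nu d k) ≤
      ENNReal.ofReal (2 * δ * R ^ ((d : ℝ) * ((k : ℝ) - (d : ℝ)) / ((d : ℝ) + 1))) ∧
    ∀ r : ℝ, 0 < r →
      T k (F.indicator (fun _ => (1 : ℝ))) r ≤ (max r R) ^ ((k : ℝ) - (d : ℝ)) * δ := by
  have hlt : k < d := by omega
  refine ⟨?_, fun r hr => T_indicator_le hk hlt hR hFmeas hFsub hδ hFmu hr⟩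
  calc eLpNorm (T k (F.indicator (fun _ => (1 : ℝ)))) (ENNReal.ofReal (qExp d)) (nu d k)
      ≤ eLpNorm (δ • fun r => (max r R) ^ ((k : ℝ) - (d : ℝ)))
          (ENNReal.ofReal (qExp d)) (nu d k) := by
        refine eLpNorm_mono_ae ?_
        have hpos : ∀ᵐ r ∂(nu d k), r ∈ Ioi (0 : ℝ) :=
          (withDensity_absolutelyContinuous _ _).ae_le (ae_restrict_mem measurableSet_Ioi)
        filter_upwards [hpos] with r hr
        rw [Real.norm_of_nonneg (T_indicator_nonneg k F hr)]
        refine (T_indicator_le hk hlt hR hFmeas hFsub hδ hFmu hr).trans ?_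
        rw [Pi.smul_apply, smul_eq_mul, mul_comm]
        exact le_abs_self _
    _ ≤ ENNReal.ofReal δ *
          ENNReal.ofReal (2 * R ^ ((d : ℝ) * ((k : ℝ) - (d : ℝ)) / ((d : ℝ) + 1))) := by
        rw [eLpNorm_const_smul, Real.enorm_of_nonneg hδ]
        exact mul_le_mul_right (eLpNorm_max_rpow_le hlt hR) _
    _ = _ := by
        rw [← ENNReal.ofReal_mul hδ]
        congr 1
        ring
end
end

section
/- Let k = 1 and d ≥ 3. There exists a constant C = C(d) such that for every R ≥ 1 and every measurable set F ⊆ [R, ∞) with μ(F) ≤ 1, one has ‖T 1_F‖_{L^q(ν)} ≤ C R^{−1/q}. -/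
open MeasureTheory Set Filter Topology

noncomputable section

theorem lintegral_Ioc_ofReal_deriv {g g' : ℝ → ℝ} {a b : ℝ} (hab : a ≤ b)
    (hcont : ContinuousOn g (Icc a b)) (hderiv : ∀ x ∈ Ioo a b, HasDerivAt g (g' x) x)
    (hpos : ∀ x ∈ Ioc a b, 0 ≤ g' x) :
    ∫⁻ x in Ioc a b, ENNReal.ofReal (g' x) = ENNReal.ofReal (g b - g a) := by
  have hpos' : ∀ x ∈ Ioo a b, 0 ≤ g' x := fun x hx => hpos x (Ioo_subset_Ioc_self hx)
  have hint : IntegrableOn g' (Ioc a b) :=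
    intervalIntegral.integrableOn_deriv_of_nonneg hcont hderiv hpos'
  rw [← intervalIntegral.integral_eq_sub_of_hasDerivAt_of_le hab hcont hderiv
      ((intervalIntegrable_iff_integrableOn_Ioc_of_le hab).2 hint),
    intervalIntegral.integral_of_le hab, ofReal_integral_eq_lintegral_ofReal hint]
  filter_upwards [ae_restrict_mem measurableSet_Ioc] with x hx using hpos x hx

/-- The kernel of `T 1`; for `0 < u ≤ r` it vanishes because the square root of a nonpositive
real and division by zero are both zero by convention. -/
def abelKernel (r u : ℝ) : ENNReal := ENNReal.ofReal (u / √(u ^ 2 - r ^ 2))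

theorem measurable_abelKernel : Measurable (Function.uncurry abelKernel) := by
  unfold abelKernel Function.uncurry
  fun_prop

theorem abelKernel_eq_zero {r u : ℝ} (hu : 0 ≤ u) (h : u ≤ r) : abelKernel r u = 0 := by
  have : u ^ 2 - r ^ 2 ≤ 0 := by nlinarith
  simp [abelKernel, Real.sqrt_eq_zero_of_nonpos this]

theorem lintegral_abelKernel_near {r c : ℝ} (hr : 0 < r) (hc : 0 ≤ c) :
    ∫⁻ u in Ioc r (√(r ^ 2 + c)), abelKernel r u = ENNReal.ofReal (√c) := by
  have hle : r ≤ √(r ^ 2 + c) := Real.le_sqrt_of_sq_le (by linarith)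
  have key := lintegral_Ioc_ofReal_deriv (g := fun u => √(u ^ 2 - r ^ 2))
    (g' := fun u => u / √(u ^ 2 - r ^ 2)) hle (by fun_prop) ?_ ?_
  · rw [Real.sq_sqrt (by positivity)] at key
    simpa [abelKernel] using key
  · intro u hu
    have hpos : 0 < u ^ 2 - r ^ 2 := by nlinarith [hu.1]
    have h := (((hasDerivAt_pow 2 u).sub_const (r ^ 2)).sqrt hpos.ne')
    convert h using 1
    have := (Real.sqrt_pos.2 hpos).ne'
    push_cast
    field_simp
  · intro u hu
    have : 0 < u := hr.trans hu.1
    positivity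

theorem lintegral_mul_abelKernel {u : ℝ} (hu : 0 < u) :
    ∫⁻ r in Ioc 0 u, ENNReal.ofReal r * abelKernel r u = ENNReal.ofReal (u ^ 2) := by
  have key := lintegral_Ioc_ofReal_deriv (g := fun r => -(u * √(u ^ 2 - r ^ 2)))
    (g' := fun r => r * (u / √(u ^ 2 - r ^ 2))) hu.le (by fun_prop) ?_ ?_
  · have e : ∀ r ∈ Ioc 0 u, ENNReal.ofReal r * abelKernel r u
        = ENNReal.ofReal (r * (u / √(u ^ 2 - r ^ 2))) := fun r hr => by
      rw [abelKernel, ← ENNReal.ofReal_mul hr.1.le]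
    rw [setLIntegral_congr_fun measurableSet_Ioc e, key]
    congr 1
    rw [sub_self, Real.sqrt_zero, zero_pow two_ne_zero, sub_zero, Real.sqrt_sq hu.le]
    ring
  · intro r hr
    have hpos : 0 < u ^ 2 - r ^ 2 := by nlinarith [hr.1, hr.2]
    have h := ((((hasDerivAt_pow 2 r).const_sub (u ^ 2)).sqrt hpos.ne').const_mul u).neg
    refine h.congr_deriv ?_
    have := (Real.sqrt_pos.2 hpos).ne'
    push_cast
    field_simp
  · intro r hr
    have := hr.1
    positivity

theorem mu_apply_of_subset_Ici {d : ℕ} {R : ℝ} (hR : 0 < R) {F : Set ℝ} (hF : MeasurableSet F)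
    (hsub : F ⊆ Ici R) : mu d F = ∫⁻ u in F, ENNReal.ofReal (u ^ (d - 1)) := by
  have : F ∩ Ioi 0 = F := inter_eq_left.2 fun u hu => hR.trans_le (hsub hu)
  rw [mu, withDensity_apply _ hF, Measure.restrict_restrict hF, this]

theorem lintegral_abelKernel_le {d : ℕ} (hd : 3 ≤ d) {R : ℝ} (hR : 1 ≤ R) {F : Set ℝ}
    (hF : MeasurableSet F) (hsub : F ⊆ Ici R) (hmu : mu d F ≤ 1) {r : ℝ} (hr : 0 < r) :
    ∫⁻ u in F, abelKernel r u ≤ ENNReal.ofReal (2 / √R) := by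
  have hR0 : 0 < R := by linarith
  have hsR : 0 < √R := Real.sqrt_pos.2 hR0
  set s := √(r ^ 2 + R⁻¹) with hs
  have hpt : ∀ u ∈ F, abelKernel r u ≤ (Ioc r s).indicator (abelKernel r) u
      + ENNReal.ofReal (√R)⁻¹ * ENNReal.ofReal (u ^ (d - 1)) := by
    intro u hu
    have hRu : R ≤ u := hsub hu
    have hu1 : 1 ≤ u := hR.trans hRu
    rcases le_or_gt u r with h | h
    · simp [abelKernel_eq_zero (by linarith : 0 ≤ u) h]
    rcases le_or_gt u s with h' | h'
    · rw [indicator_of_mem (show u ∈ Ioc r s from ⟨h, h'⟩)]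
      exact le_self_add
    refine le_add_left ?_
    rw [abelKernel, ← ENNReal.ofReal_mul (by positivity)]
    apply ENNReal.ofReal_le_ofReal
    have hfar : R⁻¹ ≤ u ^ 2 - r ^ 2 := by
      have := (Real.sqrt_lt' (by linarith : 0 < u)).1 h'
      linarith
    have h1 : (√R)⁻¹ ≤ √(u ^ 2 - r ^ 2) := by
      rw [← Real.sqrt_inv]
      exact Real.sqrt_le_sqrt hfar
    have h2 : R * u ≤ u ^ (d - 1) := calc
      R * u ≤ u ^ 2 := by nlinarith
      _ ≤ u ^ (d - 1) := pow_le_pow_right₀ hu1 (by omega)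
    calc u / √(u ^ 2 - r ^ 2) ≤ u / (√R)⁻¹ := by gcongr
      _ = (√R)⁻¹ * (R * u) := by
        have := Real.mul_self_sqrt hR0.le
        field_simp
        nlinarith
      _ ≤ _ := by gcongr
  have hmeas : Measurable (abelKernel r) := measurable_abelKernel.comp measurable_prodMk_left
  calc ∫⁻ u in F, abelKernel r u
      ≤ ∫⁻ u in F, ((Ioc r s).indicator (abelKernel r) u
          + ENNReal.ofReal (√R)⁻¹ * ENNReal.ofReal (u ^ (d - 1))) :=
        setLIntegral_mono' hF hpt
    _ = (∫⁻ u in F, (Ioc r s).indicator (abelKernel r) u)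
          + ENNReal.ofReal (√R)⁻¹ * mu d F := by
        rw [lintegral_add_left (hmeas.indicator measurableSet_Ioc),
          lintegral_const_mul _ (by fun_prop), mu_apply_of_subset_Ici hR0 hF hsub]
    _ ≤ ENNReal.ofReal (√R)⁻¹ + ENNReal.ofReal (√R)⁻¹ := by
        gcongr
        · calc ∫⁻ u in F, (Ioc r s).indicator (abelKernel r) u
              ≤ ∫⁻ u, (Ioc r s).indicator (abelKernel r) u := setLIntegral_le_lintegral _ _
            _ = ENNReal.ofReal (√R)⁻¹ := by
              rw [lintegral_indicator measurableSet_Ioc, hs,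
                lintegral_abelKernel_near hr (by positivity), Real.sqrt_inv]
        · exact mul_le_of_le_one_right' hmu
    _ = ENNReal.ofReal (2 / √R) := by
        rw [← ENNReal.ofReal_add (by positivity) (by positivity)]
        congr 1
        ring

theorem lintegral_nu_lintegral_abelKernel_le {d : ℕ} (hd : 3 ≤ d) {R : ℝ} (hR : 1 ≤ R) {F : Set ℝ}
    (hF : MeasurableSet F) (hsub : F ⊆ Ici R) :
    ∫⁻ r, ∫⁻ u in F, abelKernel r u ∂volume ∂(nu d 1) ≤ mu d F := by
  have hR0 : 0 < R := by linarith
  have hmeas : Measurable fun r => ∫⁻ u in F, abelKernel r u :=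
    Measurable.lintegral_prod_right measurable_abelKernel
  rw [nu, lintegral_withDensity_eq_lintegral_mul _ (by fun_prop) hmeas,
    mu_apply_of_subset_Ici hR0 hF hsub]
  simp only [Pi.mul_apply]
  have e : ∀ r : ℝ, ENNReal.ofReal (r ^ (d - 1 - 1)) * ∫⁻ u in F, abelKernel r u
      = ∫⁻ u in F, ENNReal.ofReal (r ^ (d - 1 - 1)) * abelKernel r u := fun r =>
    (lintegral_const_mul _ (measurable_abelKernel.comp measurable_prodMk_left)).symm
  simp only [e]
  rw [lintegral_lintegral_swap]
  swap
  · have := measurable_abelKernel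
    unfold Function.uncurry at this
    exact Measurable.aemeasurable (by unfold Function.uncurry; fun_prop)
  refine setLIntegral_mono' hF fun u hu => ?_
  have hu0 : 0 < u := hR0.trans_le (hsub hu)
  have hpt : ∀ r ∈ Ioi (0 : ℝ), ENNReal.ofReal (r ^ (d - 1 - 1)) * abelKernel r u
      ≤ (Ioc 0 u).indicator (fun r => ENNReal.ofReal (u ^ (d - 3))
          * (ENNReal.ofReal r * abelKernel r u)) r := by
    intro r hr
    have hr0 : 0 < r := hr
    rcases le_or_gt r u with h | h
    · rw [indicator_of_mem (show r ∈ Ioc 0 u from ⟨hr0, h⟩), ← mul_assoc,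
        ← ENNReal.ofReal_mul (by positivity)]
      gcongr
      rw [show d - 1 - 1 = (d - 3) + 1 by omega, pow_succ]
      gcongr
    · simp [abelKernel_eq_zero hu0.le h.le]
  calc _ ≤ ∫⁻ r in Ioi 0, (Ioc 0 u).indicator (fun r => ENNReal.ofReal (u ^ (d - 3))
          * (ENNReal.ofReal r * abelKernel r u)) r := setLIntegral_mono' measurableSet_Ioi hpt
    _ ≤ ∫⁻ r, (Ioc 0 u).indicator (fun r => ENNReal.ofReal (u ^ (d - 3))
          * (ENNReal.ofReal r * abelKernel r u)) r := setLIntegral_le_lintegral _ _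
    _ = ENNReal.ofReal (u ^ (d - 3)) * ENNReal.ofReal (u ^ 2) := by
        rw [lintegral_indicator measurableSet_Ioc,
          lintegral_const_mul' _ _ ENNReal.ofReal_ne_top, lintegral_mul_abelKernel hu0]
    _ = ENNReal.ofReal (u ^ (d - 1)) := by
        rw [← ENNReal.ofReal_mul (by positivity), ← pow_add, show d - 3 + 2 = d - 1 by omega]

theorem enorm_T_one_indicator_le {F : Set ℝ} (hF : MeasurableSet F) {r : ℝ} (hr : 0 < r) :
    ‖T 1 (F.indicator fun _ => (1 : ℝ)) r‖ₑ ≤ ∫⁻ u in F, abelKernel r u := by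
  refine (enorm_integral_le_lintegral_enorm _).trans ?_
  rw [← lintegral_indicator hF]
  refine (setLIntegral_mono' (g := F.indicator (abelKernel r)) measurableSet_Ioi
    fun u hu => ?_).trans (setLIntegral_le_lintegral _ _)
  by_cases huF : u ∈ F
  · have hru : r < u := hu
    have hpos : 0 < u ^ 2 - r ^ 2 := by nlinarith
    have hu0 : 0 < u := hr.trans hru
    rw [indicator_of_mem huF, indicator_of_mem huF, abelKernel, Real.sqrt_eq_rpow,
      show ((1 : ℕ) : ℝ) / 2 - 1 = -(1 / 2) by norm_num, Real.rpow_neg hpos.le,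
      Real.enorm_of_nonneg (by positivity)]
    apply ENNReal.ofReal_le_ofReal
    rw [one_mul, mul_comm, ← div_eq_mul_inv]
  · simp [huF]

/-- bound on `T 1_F` for sets `F` far from the origin, case `k = 1`. -/
theorem T_indicator_far_set_bound_k_eq_one
    (d : ℕ) (hd : 3 ≤ d) :
    ∃ C : ℝ, 0 ≤ C ∧
      ∀ R : ℝ, 1 ≤ R → ∀ F : Set ℝ, MeasurableSet F → F ⊆ Ici R →
        mu d F ≤ 1 →
        eLpNorm (T 1 (F.indicator (fun _ => (1 : ℝ)))) (ENNReal.ofReal (qExp d)) (nu d 1) ≤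
          ENNReal.ofReal (C * R ^ (-(1 : ℝ) / qExp d)) := by
  refine ⟨2, by norm_num, fun R hR F hF hsub hmu => ?_⟩
  have hR0 : 0 < R := by linarith
  have hq : 0 < qExp d := by unfold qExp; positivity
  have hqne : ENNReal.ofReal (qExp d) ≠ 0 := by simpa using hq
  have hae : ∀ᵐ r ∂(nu d 1), r ∈ Ioi (0 : ℝ) :=
    (withDensity_absolutelyContinuous _ _).ae_le (ae_restrict_mem measurableSet_Ioi)
  have hpow : (2 / √R) ^ d ≤ 2 ^ qExp d * R⁻¹ := by
    have hs1 : 1 ≤ √R := Real.one_le_sqrt.2 hR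
    have hRd : R ≤ √R ^ d := calc
      R = √R ^ 2 := (Real.sq_sqrt hR0.le).symm
      _ ≤ √R ^ d := pow_le_pow_right₀ hs1 (by omega)
    have h2 : (2 : ℝ) ^ d ≤ 2 ^ qExp d := by
      rw [← Real.rpow_natCast]
      exact Real.rpow_le_rpow_of_exponent_le one_le_two (by simp [qExp])
    rw [div_pow, div_eq_mul_inv]
    gcongr
  have hmain : ∫⁻ r, ‖T 1 (F.indicator fun _ => (1 : ℝ)) r‖ₑ ^ qExp d ∂(nu d 1)
      ≤ ENNReal.ofReal (2 ^ qExp d * R⁻¹) := calc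
    _ ≤ ∫⁻ r, ENNReal.ofReal (2 / √R) ^ d * (∫⁻ u in F, abelKernel r u) ∂(nu d 1) := by
        refine lintegral_mono_ae ?_
        filter_upwards [hae] with r hr
        rw [show qExp d = ((d + 1 : ℕ) : ℝ) by simp [qExp], ENNReal.rpow_natCast, pow_succ]
        have h := enorm_T_one_indicator_le hF hr
        gcongr
        exact h.trans (lintegral_abelKernel_le hd hR hF hsub hmu hr)
    _ = ENNReal.ofReal (2 / √R) ^ d * ∫⁻ r, (∫⁻ u in F, abelKernel r u) ∂(nu d 1) :=
        lintegral_const_mul' _ _ (by finiteness)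
    _ ≤ ENNReal.ofReal (2 / √R) ^ d :=
        mul_le_of_le_one_right'
          ((lintegral_nu_lintegral_abelKernel_le hd hR hF hsub).trans hmu)
    _ ≤ _ := by
        rw [← ENNReal.ofReal_pow (by positivity)]
        exact ENNReal.ofReal_le_ofReal hpow
  rw [eLpNorm_eq_lintegral_rpow_enorm_toReal hqne ENNReal.ofReal_ne_top,
    ENNReal.toReal_ofReal hq.le]
  refine (ENNReal.rpow_le_rpow hmain (by positivity)).trans_eq ?_
  rw [ENNReal.ofReal_rpow_of_nonneg (by positivity) (by positivity),
    Real.mul_rpow (by positivity) (by positivity), ← Real.rpow_mul (by norm_num),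
    mul_one_div_cancel hq.ne', Real.rpow_one, Real.inv_rpow hR0.le, ← Real.rpow_neg hR0.le, neg_div]
end
end

section
/- Let k = 1 and d ≥ 3. There exists a constant C = C(d) such that for all ρ ≥ R ≥ 1 and all δ > 0 with δ ρ^{d−1} ≤ 1, the interval F = (ρ, ρ+δ) satisfies ‖T 1_F‖_{L^q(ν)}^q ≤ C / R. -/
open MeasureTheory Set Filter Topology

noncomputable section

theorem T_one_indicator_Ioo_eq_zero {a b r : ℝ} (hr : b ≤ r) :
    T 1 ((Ioo a b).indicator (fun _ => (1 : ℝ))) r = 0 := by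
  unfold T
  refine setIntegral_eq_zero_of_forall_eq_zero fun u hu => ?_
  have hu' : u ∉ Ioo a b := fun h => absurd (h.2.trans_le hr) (not_lt.2 (le_of_lt hu))
  simp [indicator_of_notMem hu']

theorem integral_rpow_neg_half_sq_sub_sq {r m s : ℝ} (hr : 0 < r) (hrm : r ≤ m) (hms : m ≤ s) :
    ∫ u in m..s, (u ^ 2 - r ^ 2) ^ (-(1 / 2) : ℝ) * u =
      √(s ^ 2 - r ^ 2) - √(m ^ 2 - r ^ 2) := by
  have hcont : ContinuousOn (fun u : ℝ => √(u ^ 2 - r ^ 2)) (Icc m s) := by fun_prop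
  have hderiv : ∀ u ∈ Ioo m s, HasDerivAt (fun u : ℝ => √(u ^ 2 - r ^ 2))
      ((u ^ 2 - r ^ 2) ^ (-(1 / 2) : ℝ) * u) u := by
    intro u hu
    have hpos : 0 < u ^ 2 - r ^ 2 := by nlinarith [hu.1]
    have h := ((hasDerivAt_pow 2 u).sub_const (r ^ 2)).sqrt hpos.ne'
    convert h using 1
    rw [Real.rpow_neg hpos.le, ← Real.sqrt_eq_rpow]
    have := (Real.sqrt_pos.2 hpos).ne'
    simp
    field_simp
  have hnonneg : ∀ u ∈ Ioo m s, 0 ≤ (u ^ 2 - r ^ 2) ^ (-(1 / 2) : ℝ) * u := by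
    intro u hu
    exact mul_nonneg (Real.rpow_nonneg (by nlinarith [hu.1]) _) (by linarith [hu.1])
  refine intervalIntegral.integral_eq_sub_of_hasDerivAt_of_le hms hcont hderiv ?_
  apply intervalIntegral.intervalIntegrable_deriv_of_nonneg (g := fun u : ℝ => √(u ^ 2 - r ^ 2))
  · rwa [uIcc_of_le hms]
  · rwa [min_eq_left hms, max_eq_right hms]
  · rwa [min_eq_left hms, max_eq_right hms]

theorem T_one_indicator_Ioo {a b r : ℝ} (hab : a ≤ b) (hr : 0 < r) (hrb : r ≤ b) :
    T 1 ((Ioo a b).indicator (fun _ => (1 : ℝ))) r =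
      √(b ^ 2 - r ^ 2) - √((max a r) ^ 2 - r ^ 2) := by
  rw [← integral_rpow_neg_half_sq_sub_sq hr (le_max_right a r) (max_le hab hrb),
    intervalIntegral.integral_of_le (max_le hab hrb), integral_Ioc_eq_integral_Ioo]
  unfold T
  rw [← integral_indicator measurableSet_Ioi, ← integral_indicator measurableSet_Ioo]
  congr 1
  ext u
  have he : ((1 : ℕ) : ℝ) / 2 - 1 = -(1 / 2) := by norm_num
  rw [he]
  simp only [indicator, mem_Ioi, mem_Ioo, max_lt_iff]
  by_cases h1 : r < u <;> by_cases h2 : a < u <;> by_cases h3 : u < b <;> simp [h1, h2, h3]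

/-- Pointwise bounds: `T 1_F` is nonnegative, at most `2`, and decays at scale `δ` away from `ρ`. -/
theorem T_one_indicator_Ioo_bounds {ρ δ r : ℝ} (hρ : 1 ≤ ρ) (hδ : 0 < δ) (hρδ : δ * ρ ≤ 1)
    (hr : 0 < r) (hrb : r ≤ ρ + δ) :
    0 ≤ T 1 ((Ioo ρ (ρ + δ)).indicator (fun _ => (1 : ℝ))) r ∧
      T 1 ((Ioo ρ (ρ + δ)).indicator (fun _ => (1 : ℝ))) r ≤ 2 ∧
      T 1 ((Ioo ρ (ρ + δ)).indicator (fun _ => (1 : ℝ))) r ^ 4 ≤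
        90 * (1 + ((r - ρ) / δ) ^ 2)⁻¹ := by
  have hδ1 : δ ≤ 1 := by nlinarith
  rw [T_one_indicator_Ioo (by linarith) hr hrb]
  have hm : max ρ r ≤ ρ + δ := max_le (by linarith) hrb
  have hmρ : ρ ≤ max ρ r := le_max_left _ _
  have hmr : r ≤ max ρ r := le_max_right _ _
  have ha2 : √((max ρ r) ^ 2 - r ^ 2) ^ 2 = (max ρ r) ^ 2 - r ^ 2 :=
    Real.sq_sqrt (by nlinarith)
  have hb2 : √((ρ + δ) ^ 2 - r ^ 2) ^ 2 = (ρ + δ) ^ 2 - r ^ 2 := Real.sq_sqrt (by nlinarith)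
  have hab : √((max ρ r) ^ 2 - r ^ 2) ≤ √((ρ + δ) ^ 2 - r ^ 2) :=
    Real.sqrt_le_sqrt (by nlinarith)
  have ha0 : 0 ≤ √((max ρ r) ^ 2 - r ^ 2) := Real.sqrt_nonneg _
  have hdiff : (ρ + δ) ^ 2 - (max ρ r) ^ 2 ≤ 3 * (δ * ρ) := by nlinarith
  generalize √((ρ + δ) ^ 2 - r ^ 2) = b at *
  generalize √((max ρ r) ^ 2 - r ^ 2) = a at *
  obtain ⟨t, ht⟩ : ∃ t, t = b - a := ⟨_, rfl⟩
  rw [← ht]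
  have ht0 : 0 ≤ t := by linarith
  have hbt : b = a + t := by linarith
  have hprod : t * (t + 2 * a) ≤ 3 * (δ * ρ) := by
    rw [hbt] at hb2
    nlinarith
  have hta : 0 ≤ t * a := mul_nonneg ht0 ha0
  have ht2 : t ^ 2 ≤ 3 := by nlinarith
  have ht4 : t ^ 4 ≤ 9 := by nlinarith [sq_nonneg t]
  refine ⟨ht0, by nlinarith, ?_⟩
  have hkey : t ^ 4 * (δ ^ 2 + (r - ρ) ^ 2) ≤ 90 * δ ^ 2 := by
    rcases le_total ρ r with h | h
    · have h1 : (r - ρ) ^ 2 ≤ δ ^ 2 := by nlinarith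
      nlinarith [mul_le_mul ht4 (add_le_add_right h1 (δ ^ 2)) (by positivity) (by norm_num)]
    · rw [max_eq_left h] at ha2
      have h1 : ρ * (ρ - r) ≤ a ^ 2 := by nlinarith
      have h2 : (t * a) ^ 2 ≤ (3 * (δ * ρ)) ^ 2 := by
        apply pow_le_pow_left₀ hta; nlinarith [sq_nonneg t]
      have h3 : t ^ 2 * (ρ * (ρ - r)) ≤ 9 * (δ * ρ) ^ 2 := by
        nlinarith [mul_le_mul_of_nonneg_left h1 (sq_nonneg t)]
      have h4 : t ^ 2 * (ρ - r) ≤ 9 * δ * (δ * ρ) := by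
        have : ρ * (t ^ 2 * (ρ - r)) ≤ ρ * (9 * δ * (δ * ρ)) := by nlinarith
        exact le_of_mul_le_mul_left this (by linarith)
      have h5 : t ^ 2 * (ρ - r) ≤ 9 * δ := by nlinarith
      have h6 : (t ^ 2 * (ρ - r)) ^ 2 ≤ (9 * δ) ^ 2 :=
        pow_le_pow_left₀ (mul_nonneg (sq_nonneg t) (by linarith)) h5 2
      nlinarith [mul_le_mul_of_nonneg_right ht4 (sq_nonneg δ)]
  have hrw : 1 + ((r - ρ) / δ) ^ 2 = (δ ^ 2 + (r - ρ) ^ 2) / δ ^ 2 := by field_simp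
  rw [hrw, inv_div, ← mul_div_assoc, le_div_iff₀ (by positivity)]
  exact hkey

theorem lintegral_cauchy_profile (ρ : ℝ) {δ : ℝ} (hδ : 0 < δ) :
    ∫⁻ r, ENNReal.ofReal ((1 + ((r - ρ) / δ) ^ 2)⁻¹) = ENNReal.ofReal (δ * Real.pi) := by
  have hint : Integrable fun r : ℝ => (1 + ((r - ρ) / δ) ^ 2)⁻¹ :=
    (integrable_inv_one_add_sq.comp_div hδ.ne').comp_sub_right ρ
  rw [← ofReal_integral_eq_lintegral_ofReal hint (ae_of_all _ fun r => by positivity)]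
  congr 1
  rw [integral_sub_right_eq_self (fun r : ℝ => (1 + (r / δ) ^ 2)⁻¹) ρ,
    Measure.integral_comp_div (fun r : ℝ => (1 + r ^ 2)⁻¹) δ, integral_univ_inv_one_add_sq,
    abs_of_pos hδ, smul_eq_mul]

/-- bound on `T 1_F` when `F` is a far-away interval, case `k = 1`. -/
theorem T_indicator_far_interval_bound_k_eq_one
    (d : ℕ) (hd : 3 ≤ d) :
    ∃ C : ℝ, 0 ≤ C ∧
      ∀ ρ R δ : ℝ, 1 ≤ R → R ≤ ρ → 0 < δ → δ * ρ ^ (d - 1) ≤ 1 →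
        (∫⁻ r, ENNReal.ofReal
            ((T 1 ((Ioo ρ (ρ + δ)).indicator (fun _ => (1 : ℝ))) r) ^ (qExp d))
          ∂(nu d 1)) ≤ ENNReal.ofReal (C / R) := by
  refine ⟨90 * 2 ^ (d - 3) * 2 ^ (d - 2) * Real.pi, by positivity, ?_⟩
  intro ρ R δ hR hRρ hδ hδρ
  have hρ : 1 ≤ ρ := hR.trans hRρ
  have hρδ : δ * ρ ≤ 1 :=
    (mul_le_mul_of_nonneg_left (le_self_pow₀ hρ (by omega)) hδ.le).trans hδρ
  have hδ1 : δ ≤ 1 := by nlinarith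
  have hpt : ∀ r ∈ Ioi (0 : ℝ),
      ENNReal.ofReal (r ^ (d - 1 - 1)) * ENNReal.ofReal
        ((T 1 ((Ioo ρ (ρ + δ)).indicator (fun _ => (1 : ℝ))) r) ^ (qExp d)) ≤
      ENNReal.ofReal (90 * 2 ^ (d - 3) * (2 * ρ) ^ (d - 2)) *
        ENNReal.ofReal ((1 + ((r - ρ) / δ) ^ 2)⁻¹) := by
    intro r hr
    have hr0 : 0 < r := hr
    have hq : qExp d = ((d + 1 : ℕ) : ℝ) := by simp [qExp]
    rw [hq, Real.rpow_natCast, ← ENNReal.ofReal_mul (by positivity),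
      ← ENNReal.ofReal_mul (by positivity)]
    apply ENNReal.ofReal_le_ofReal
    rcases le_total r (ρ + δ) with h | h
    · obtain ⟨h0, h2, h4⟩ := T_one_indicator_Ioo_bounds hρ hδ hρδ hr0 h
      generalize T 1 ((Ioo ρ (ρ + δ)).indicator (fun _ => (1 : ℝ))) r = t at *
      have hd1 : d + 1 = (d - 3) + 4 := by omega
      have hd2 : d - 1 - 1 = d - 2 := by omega
      rw [hd1, pow_add, hd2]
      calc r ^ (d - 2) * (t ^ (d - 3) * t ^ 4)
          ≤ (2 * ρ) ^ (d - 2) * (2 ^ (d - 3) * (90 * (1 + ((r - ρ) / δ) ^ 2)⁻¹)) := by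
            gcongr
            linarith
        _ = _ := by ring
    · rw [T_one_indicator_Ioo_eq_zero h, zero_pow (by omega), mul_zero]
      positivity
  unfold nu
  rw [lintegral_withDensity_eq_lintegral_mul_non_measurable _ (by fun_prop)
    (ae_of_all _ fun r => ENNReal.ofReal_lt_top)]
  calc _ ≤ ∫⁻ r in Ioi (0 : ℝ), ENNReal.ofReal (90 * 2 ^ (d - 3) * (2 * ρ) ^ (d - 2)) *
        ENNReal.ofReal ((1 + ((r - ρ) / δ) ^ 2)⁻¹) :=
        setLIntegral_mono' measurableSet_Ioi hpt
    _ ≤ ∫⁻ r, ENNReal.ofReal (90 * 2 ^ (d - 3) * (2 * ρ) ^ (d - 2)) *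
        ENNReal.ofReal ((1 + ((r - ρ) / δ) ^ 2)⁻¹) := setLIntegral_le_lintegral _ _
    _ = ENNReal.ofReal (90 * 2 ^ (d - 3) * (2 * ρ) ^ (d - 2) * (δ * Real.pi)) := by
        rw [lintegral_const_mul' _ _ ENNReal.ofReal_ne_top, lintegral_cauchy_profile ρ hδ,
          ← ENNReal.ofReal_mul (by positivity)]
    _ ≤ _ := by
        apply ENNReal.ofReal_le_ofReal
        rw [le_div_iff₀ (by linarith), mul_pow]
        have hd1 : d - 1 = (d - 2) + 1 := by omega
        rw [hd1, pow_succ] at hδρ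
        have hRδ : δ * (ρ ^ (d - 2) * R) ≤ 1 := le_trans (by gcongr) hδρ
        calc _ = 90 * 2 ^ (d - 3) * 2 ^ (d - 2) * Real.pi * (δ * (ρ ^ (d - 2) * R)) := by ring
          _ ≤ _ := mul_le_of_le_one_right (by positivity) hRδ
end
end
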